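/- For each p > 1, the classes M^p and N^p coincide as sets of holomorphic functions on 𝔻, and the metric spaces (M^p, ρ_p) and (N^p, d_p) have the same topological structure, i.e., the identity map between them is a homeomorphism. -/

import Mathlib

open MeasureTheory Filter Set
open scoped ENNReal Topology Real NNReal

noncomputable section

/-- The open unit disk in the complex plane. -/
def unitDisk : Set ℂ := Metric.ball 0 1

/-- The point `r·e^{iθ}`. -/
def circlePt (r θ : ℝ) : ℂ := (r : ℂ) * Complex.exp (θ * Complex.I)

/-- The maximal radial function `Mf(θ) = sup_{0 ≤ r < 1} |f(r e^{iθ})|`, valued in `ℝ≥0∞`. -/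
def maxRad (f : ℂ → ℂ) (θ : ℝ) : ℝ≥0∞ :=
  ⨆ r ∈ Set.Ico (0 : ℝ) 1, (‖f (circlePt r θ)‖₊ : ℝ≥0∞)

/-- `log⁺` on `ℝ≥0∞`. -/
def elogPlus (x : ℝ≥0∞) : ℝ≥0∞ :=
  if x = ∞ then ∞ else ENNReal.ofReal (Real.log x.toReal)

/-- `x ↦ log (1 + x)` on `ℝ≥0∞`. -/
def elog1p (x : ℝ≥0∞) : ℝ≥0∞ :=
  if x = ∞ then ∞ else ENNReal.ofReal (Real.log (1 + x.toReal))

/-- The radial boundary value `f*(e^{iθ}) = lim_{r→1⁻} f(r e^{iθ})`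
(a junk value is returned where the limit does not exist). -/
def radialLimit (f : ℂ → ℂ) (θ : ℝ) : ℂ :=
  limUnder (nhdsWithin (1 : ℝ) (Set.Iio 1)) fun r : ℝ => f (circlePt r θ)

/-- The class `M^p`: holomorphic functions on the unit disk with
`∫₀^{2π} (log⁺ Mf(θ))^p dθ/2π < ∞`. -/
def MpClass (p : ℝ) : Set (ℂ → ℂ) :=
  {f | DifferentiableOn ℂ f unitDisk ∧
    (∫⁻ θ in Set.Ioc 0 (2 * π), elogPlus (maxRad f θ) ^ p) / ENNReal.ofReal (2 * π) < ∞}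

/-- The metric `ρ_p` on `M^p`. -/
def rhoMetric (p : ℝ) (f g : ℂ → ℂ) : ℝ≥0∞ :=
  ((∫⁻ θ in Set.Ioc 0 (2 * π), elog1p (maxRad (f - g) θ) ^ p) /
    ENNReal.ofReal (2 * π)) ^ (1 / p)

/-- The Privalov class `N^p`: holomorphic functions on the unit disk with
`sup_{0≤r<1} ∫₀^{2π} (log⁺|f(re^{iθ})|)^p dθ/2π < ∞`. -/
def NpClass (p : ℝ) : Set (ℂ → ℂ) :=
  {f | DifferentiableOn ℂ f unitDisk ∧
    (⨆ r ∈ Set.Ico (0 : ℝ) 1,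
      (∫⁻ θ in Set.Ioc 0 (2 * π),
        ENNReal.ofReal (Real.log ‖f (circlePt r θ)‖) ^ p) / ENNReal.ofReal (2 * π)) < ∞}

/-- The metric `d_p` on `N^p`, defined via boundary values. -/
def dMetric (p : ℝ) (f g : ℂ → ℂ) : ℝ≥0∞ :=
  ((∫⁻ θ in Set.Ioc 0 (2 * π),
      ENNReal.ofReal (Real.log (1 + ‖radialLimit f θ - radialLimit g θ‖)) ^ p) /
    ENNReal.ofReal (2 * π)) ^ (1 / p)

/-- The Hardy space `H^p`. -/
def HpClass (p : ℝ) : Set (ℂ → ℂ) :=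
  {f | DifferentiableOn ℂ f unitDisk ∧
    (⨆ r ∈ Set.Ico (0 : ℝ) 1,
      (∫⁻ θ in Set.Ioc 0 (2 * π), (‖f (circlePt r θ)‖₊ : ℝ≥0∞) ^ p) /
        ENNReal.ofReal (2 * π)) < ∞}

/-- The Smirnov class `N⁺`. -/
def SmirnovClass : Set (ℂ → ℂ) :=
  {f | DifferentiableOn ℂ f unitDisk ∧
    (∫⁻ θ in Set.Ioc 0 (2 * π), ENNReal.ofReal (Real.log ‖radialLimit f θ‖)) /
      ENNReal.ofReal (2 * π) < ∞ ∧
    Tendsto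
      (fun r : ℝ => (∫⁻ θ in Set.Ioc 0 (2 * π),
        ENNReal.ofReal (Real.log ‖f (circlePt r θ)‖)) / ENNReal.ofReal (2 * π))
      (nhdsWithin (1 : ℝ) (Set.Iio 1))
      (nhds ((∫⁻ θ in Set.Ioc 0 (2 * π),
        ENNReal.ofReal (Real.log ‖radialLimit f θ‖)) / ENNReal.ofReal (2 * π)))}

/-- The normalized Blaschke factor `(|a|/a)·(a − z)/(1 − conj a · z)`. -/
def blaschkeFactor (a z : ℂ) : ℂ :=
  ((‖a‖ : ℂ) / a) * ((a - z) / (1 - (starRingEnd ℂ) a * z))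

/-- `B` is a (finite or infinite) Blaschke product on the unit disk. -/
def IsBlaschkeProduct (B : ℂ → ℂ) : Prop :=
  ∃ m : ℕ,
    (∃ n : ℕ, ∃ a : ℕ → ℂ, (∀ k < n, a k ∈ unitDisk ∧ a k ≠ 0) ∧
      ∀ z ∈ unitDisk, B z = z ^ m * ∏ k ∈ Finset.range n, blaschkeFactor (a k) z) ∨
    (∃ a : ℕ → ℂ, (∀ k, a k ∈ unitDisk ∧ a k ≠ 0) ∧ (Summable fun k => 1 - ‖a k‖) ∧
      ∀ z ∈ unitDisk, B z = z ^ m * ∏' k, blaschkeFactor (a k) z)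

/-- `I` is an ideal of the ring `M^p`. -/
structure IsIdealIn (p : ℝ) (I : Set (ℂ → ℂ)) : Prop where
  subset : I ⊆ MpClass p
  zero_mem : (0 : ℂ → ℂ) ∈ I
  add_mem : ∀ f ∈ I, ∀ g ∈ I, f + g ∈ I
  neg_mem : ∀ f ∈ I, -f ∈ I
  mul_mem : ∀ f ∈ MpClass p, ∀ g ∈ I, f * g ∈ I

/-- `I` is a prime ideal of the ring `M^p`: an ideal such that whenever a product of two
elements of `M^p` lies in `I`, one of the factors lies in `I`. -/
def IsPrimeIdealIn (p : ℝ) (I : Set (ℂ → ℂ)) : Prop :=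
  IsIdealIn p I ∧ ∀ f ∈ MpClass p, ∀ g ∈ MpClass p, f * g ∈ I → f ∈ I ∨ g ∈ I

/-- `I` is a dense subset of the metric space `(M^p, ρ_p)`. -/
def IsDenseIn (p : ℝ) (I : Set (ℂ → ℂ)) : Prop :=
  ∀ f ∈ MpClass p, ∀ ε : ℝ≥0∞, 0 < ε → ∃ g ∈ I, rhoMetric p f g < ε

/-- `I` is an ideal of the ring `N^p`. -/
structure IsIdealInNp (p : ℝ) (I : Set (ℂ → ℂ)) : Prop where
  subset : I ⊆ NpClass p
  zero_mem : (0 : ℂ → ℂ) ∈ I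
  add_mem : ∀ f ∈ I, ∀ g ∈ I, f + g ∈ I
  neg_mem : ∀ f ∈ I, -f ∈ I
  mul_mem : ∀ f ∈ NpClass p, ∀ g ∈ I, f * g ∈ I

/-- `I` is a prime ideal of the ring `N^p`. -/
def IsPrimeIdealInNp (p : ℝ) (I : Set (ℂ → ℂ)) : Prop :=
  IsIdealInNp p I ∧ ∀ f ∈ NpClass p, ∀ g ∈ NpClass p, f * g ∈ I → f ∈ I ∨ g ∈ I

/-- `I` is a dense subset of the metric space `(N^p, d_p)`. -/
def IsDenseInNp (p : ℝ) (I : Set (ℂ → ℂ)) : Prop :=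
  ∀ f ∈ NpClass p, ∀ ε : ℝ≥0∞, 0 < ε → ∃ g ∈ I, dMetric p f g < ε


namespace MpNp

/-- Centered Hardy-Littlewood maximal function on the line. -/
def mhl (V : ℝ → ℝ≥0∞) (x : ℝ) : ℝ≥0∞ :=
  ⨆ s ∈ Set.Ioi (0 : ℝ), (∫⁻ y in Metric.closedBall x s, V y) / ENNReal.ofReal (2 * s)

theorem weak_type (V : ℝ → ℝ≥0∞) (t : ℝ≥0∞) (ht : t ≠ 0) :
    volume {x | t < mhl V x} ≤ 5 * (∫⁻ y, V y) / t := by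
  rcases eq_or_ne t ∞ with rfl | htop
  · simp
  rcases eq_or_ne (∫⁻ y, V y) ∞ with hV | hV
  · rw [hV]
    rw [ENNReal.mul_top (by norm_num), ENNReal.top_div_of_ne_top htop]; exact le_top
  have key : ∀ x : {x | t < mhl V x}, ∃ s : ℝ, 0 < s ∧
      t * ENNReal.ofReal (2 * s) < ∫⁻ y in Metric.closedBall x.1 s, V y := by
    rintro ⟨x, hx⟩
    simp only [mem_ofPred_eq, mhl, lt_iSup_iff] at hx
    obtain ⟨s, hs, h⟩ := hx
    refine ⟨s, hs, ?_⟩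
    have hs' : (0:ℝ) < s := hs
    rwa [ENNReal.lt_div_iff_mul_lt (Or.inl (by simp; linarith)) (Or.inl ENNReal.ofReal_ne_top)] at h
  choose r hr0 hr using key
  have hbd : ∀ a ∈ (univ : Set {x | t < mhl V x}), r a ≤ ((∫⁻ y, V y) / t).toReal := by
    intro a _
    have h1 : t * ENNReal.ofReal (2 * r a) ≤ ∫⁻ y, V y :=
      (hr a).le.trans (setLIntegral_le_lintegral _ _)
    have h2 : ENNReal.ofReal (2 * r a) ≤ (∫⁻ y, V y) / t := by
      rw [ENNReal.le_div_iff_mul_le (Or.inl ht) (Or.inl htop), mul_comm]; exact h1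
    have h3 := ENNReal.toReal_mono (ENNReal.div_ne_top hV ht) h2
    rw [ENNReal.toReal_ofReal (by linarith [hr0 a])] at h3
    linarith [hr0 a]
  obtain ⟨u, -, hdisj, hcov⟩ := Vitali.exists_disjoint_subfamily_covering_enlargement_closedBall
    univ (fun a : {x | t < mhl V x} => a.1) r _ hbd 5 (by norm_num)
  have hcount : u.Countable := by
    refine hdisj.countable_of_nonempty_interior ?_
    intro a _
    rw [interior_closedBall _ (hr0 a).ne']
    exact ⟨a.1, Metric.mem_ball_self (hr0 a)⟩
  have hsub : {x | t < mhl V x} ⊆ ⋃ b ∈ u, Metric.closedBall b.1 (5 * r b) := by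
    intro x hx
    obtain ⟨b, hb, h⟩ := hcov ⟨x, hx⟩ (mem_univ _)
    exact mem_biUnion hb (h (Metric.mem_closedBall_self (hr0 _).le))
  calc volume {x | t < mhl V x} ≤ volume (⋃ b ∈ u, Metric.closedBall b.1 (5 * r b)) :=
        measure_mono hsub
    _ ≤ ∑' b : u, volume (Metric.closedBall b.1.1 (5 * r b.1)) := measure_biUnion_le _ hcount _
    _ ≤ ∑' b : u, (5 / t) * ∫⁻ y in Metric.closedBall b.1.1 (r b.1), V y := by
        refine ENNReal.tsum_le_tsum fun b => ?_
        rw [Real.volume_closedBall]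
        have : ENNReal.ofReal (2 * (5 * r b.1)) = (5 / t) * (t * ENNReal.ofReal (2 * r b.1)) := by
          rw [← mul_assoc (5 / t), ENNReal.div_mul_cancel ht htop,
            show 2 * (5 * r b.1) = 5 * (2 * r b.1) by ring, ENNReal.ofReal_mul (by norm_num)]
          norm_num
        rw [this]
        gcongr
        exact (hr b.1).le
    _ = (5 / t) * ∑' b : u, ∫⁻ y in Metric.closedBall b.1.1 (r b.1), V y := ENNReal.tsum_mul_left
    _ = (5 / t) * ∫⁻ y in ⋃ b ∈ u, Metric.closedBall b.1 (r b), V y := by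
        rw [lintegral_biUnion hcount (fun _ _ => measurableSet_closedBall) hdisj]
    _ ≤ (5 / t) * ∫⁻ y, V y := mul_le_mul_right (setLIntegral_le_lintegral _ _) _
    _ = 5 * (∫⁻ y, V y) / t := by
        simp only [div_eq_mul_inv]; ring

theorem mhl_le_add (V : ℝ → ℝ≥0∞) (t : ℝ≥0∞) (x : ℝ) :
    mhl V x ≤ mhl ({y | t < V y}.indicator V) x + t := by
  refine iSup₂_le fun s hs => ?_
  have hs' : (0:ℝ) < s := hs
  have hpos : ENNReal.ofReal (2 * s) ≠ 0 := by simp; linarith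
  have h1 : ∫⁻ y in Metric.closedBall x s, V y ≤
      (∫⁻ y in Metric.closedBall x s, {y | t < V y}.indicator V y) + t * ENNReal.ofReal (2 * s) := by
    calc ∫⁻ y in Metric.closedBall x s, V y
        ≤ ∫⁻ y in Metric.closedBall x s, ({y | t < V y}.indicator V y + t) := by
          refine lintegral_mono fun y => ?_
          by_cases h : t < V y
          · simp [indicator, h]
          · simp [indicator, h]; exact not_lt.1 h
      _ = _ := by
          rw [lintegral_add_right _ measurable_const, setLIntegral_const, Real.volume_closedBall]
  calc _ ≤ ((∫⁻ y in Metric.closedBall x s, {y | t < V y}.indicator V y) + t * ENNReal.ofReal (2 * s)) / ENNReal.ofReal (2 * s) := by gcongr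
    _ = (∫⁻ y in Metric.closedBall x s, {y | t < V y}.indicator V y) / ENNReal.ofReal (2 * s) + t := by
        rw [ENNReal.add_div, ENNReal.mul_div_cancel_right hpos ENNReal.ofReal_ne_top]
    _ ≤ _ := by
        gcongr
        exact le_iSup₂ (f := fun s (_ : s ∈ Set.Ioi (0:ℝ)) => (∫⁻ y in Metric.closedBall x s, {y | t < V y}.indicator V y) / ENNReal.ofReal (2 * s)) s hs

theorem strong_type (q A : ℝ) (hq : 1 < q) (hA : 0 < A) :
    ∃ C : ℝ≥0∞, C ≠ ∞ ∧ ∀ (v : ℝ → ℝ) (N : ℝ → ℝ) (S : Set ℝ), Measurable v → (∀ y, 0 ≤ v y) →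
      MeasurableSet S → Measurable N → (∀ x, 0 ≤ N x) →
      (∀ x ∈ S, ENNReal.ofReal (N x) ≤ ENNReal.ofReal A * mhl (fun y => ENNReal.ofReal (v y)) x) →
      ∫⁻ x in S, ENNReal.ofReal (N x) ^ q ≤ C * ∫⁻ y, ENNReal.ofReal (v y) ^ q := by
  refine ⟨ENNReal.ofReal q * ENNReal.ofReal (10 * A) * ENNReal.ofReal ((2 * A) ^ (q-1) / (q - 1)),
    by finiteness, ?_⟩
  intro v N S hv hv0 hS hN hN0 hle
  set V : ℝ → ℝ≥0∞ := fun y => ENNReal.ofReal (v y) with hVdef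
  have hV : Measurable V := hv.ennreal_ofReal
  have hdist : ∀ t : ℝ, 0 < t → (volume.restrict S) {x | t < N x} ≤
      ENNReal.ofReal (10 * A / t) * ∫⁻ y, {y | t < 2 * A * v y}.indicator V y := by
    intro t ht
    set τ : ℝ := t / (2 * A) with hτ
    have hτ0 : 0 < τ := by positivity
    have hset : {y | ENNReal.ofReal τ < V y} = {y | t < 2 * A * v y} := by
      ext y
      simp only [mem_ofPred_eq, hVdef]
      rw [ENNReal.ofReal_lt_ofReal_iff_of_nonneg hτ0.le, hτ, div_lt_iff₀ (by positivity), mul_comm]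
    rw [Measure.restrict_apply (measurableSet_lt measurable_const hN)]
    calc volume ({x | t < N x} ∩ S)
        ≤ volume {x | ENNReal.ofReal τ < mhl ({y | ENNReal.ofReal τ < V y}.indicator V) x} := by
          refine measure_mono ?_
          rintro x ⟨hx, hxS⟩
          have hx' : t < N x := hx
          have h1 := hle x hxS
          have h2 := mhl_le_add V (ENNReal.ofReal τ) x
          simp only [mem_ofPred_eq]
          by_contra hcon
          push Not at hcon
          have h3 : mhl V x ≤ ENNReal.ofReal τ + ENNReal.ofReal τ := h2.trans (by gcongr)
          have h4 : ENNReal.ofReal (N x) ≤ ENNReal.ofReal t := by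
            refine h1.trans ((mul_le_mul_right h3 _).trans_eq ?_)
            rw [← ENNReal.ofReal_add hτ0.le hτ0.le, ← ENNReal.ofReal_mul hA.le]
            congr 1; rw [hτ]; field_simp; ring
          rw [ENNReal.ofReal_le_ofReal_iff ht.le] at h4
          linarith
      _ ≤ 5 * (∫⁻ y, {y | ENNReal.ofReal τ < V y}.indicator V y) / ENNReal.ofReal τ :=
          weak_type _ _ (by simpa using hτ0)
      _ = _ := by
          rw [hset, div_eq_mul_inv, mul_right_comm]
          congr 1
          rw [← ENNReal.ofReal_inv_of_pos hτ0, show (5:ℝ≥0∞) = ENNReal.ofReal 5 by norm_num,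
            ← ENNReal.ofReal_mul (by norm_num)]
          congr 1; rw [hτ]; field_simp; norm_num
  have hE : MeasurableSet {z : ℝ × ℝ | z.1 < 2 * A * v z.2} :=
    measurableSet_lt measurable_fst (measurable_const.mul (hv.comp measurable_snd))
  calc ∫⁻ x in S, ENNReal.ofReal (N x) ^ q = ∫⁻ x in S, ENNReal.ofReal (N x ^ q) := by
        simp_rw [ENNReal.ofReal_rpow_of_nonneg (hN0 _) (by linarith : (0:ℝ) ≤ q)]
    _ = ENNReal.ofReal q * ∫⁻ t in Ioi 0, (volume.restrict S) {a | t < N a} * ENNReal.ofReal (t ^ (q - 1)) :=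
        lintegral_rpow_eq_lintegral_meas_lt_mul _ (Eventually.of_forall hN0) hN.aemeasurable (by linarith)
    _ ≤ ENNReal.ofReal q * ∫⁻ t in Ioi 0, ∫⁻ y, ENNReal.ofReal (10 * A) * (V y *
          {z : ℝ × ℝ | z.1 < 2 * A * v z.2}.indicator (fun z => ENNReal.ofReal (z.1 ^ (q - 2))) (t, y)) := by
        refine mul_le_mul_right (setLIntegral_mono' measurableSet_Ioi fun t ht => ?_) _
        have ht' : (0:ℝ) < t := ht
        refine (mul_le_mul_left (hdist t ht') _).trans_eq ?_
        have hm : Measurable ({y | t < 2 * A * v y}.indicator V) :=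
          hV.indicator (measurableSet_lt measurable_const (measurable_const.mul hv))
        rw [mul_right_comm, ← ENNReal.ofReal_mul (by positivity), ← lintegral_const_mul _ hm]
        refine lintegral_congr fun y => ?_
        by_cases h : t < 2 * A * v y
        · simp only [indicator, mem_ofPred_eq, h, if_true]
          have h9 : ENNReal.ofReal (10 * A / t * t ^ (q - 1)) = ENNReal.ofReal (10 * A) * ENNReal.ofReal (t ^ (q - 2)) := by
            rw [← ENNReal.ofReal_mul (by positivity)]
            congr 1
            rw [show q - 1 = (q - 2) + 1 by ring, Real.rpow_add_one ht'.ne']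
            field_simp
          rw [h9]; ring
        · simp [indicator, h]
    _ = ENNReal.ofReal q * ∫⁻ y, ∫⁻ t in Ioi 0, ENNReal.ofReal (10 * A) * (V y *
          {z : ℝ × ℝ | z.1 < 2 * A * v z.2}.indicator (fun z => ENNReal.ofReal (z.1 ^ (q - 2))) (t, y)) := by
        rw [lintegral_lintegral_swap]
        refine Measurable.aemeasurable ?_
        refine Measurable.const_mul ?_ _
        refine (hV.comp measurable_snd).mul ?_
        exact (Measurable.indicator (by fun_prop) hE)
    _ = ENNReal.ofReal q * ∫⁻ y, ENNReal.ofReal (10 * A) * (ENNReal.ofReal ((2 * A) ^ (q-1) / (q - 1)) * V y ^ q) := by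
        congr 1
        refine lintegral_congr fun y => ?_
        have hm : Measurable fun t : ℝ => {z : ℝ × ℝ | z.1 < 2 * A * v z.2}.indicator (fun z => ENNReal.ofReal (z.1 ^ (q - 2))) (t, y) :=
          (Measurable.indicator (f := fun z : ℝ × ℝ => ENNReal.ofReal (z.1 ^ (q - 2))) (by fun_prop) hE).comp (by fun_prop : Measurable fun t : ℝ => (t, y))
        rw [lintegral_const_mul _ (hm.const_mul _), lintegral_const_mul _ hm]
        congr 1
        have hb : 0 ≤ 2 * A * v y := by have := hv0 y; positivity
        have h1 : ∫⁻ t in Ioi (0:ℝ), {z : ℝ × ℝ | z.1 < 2 * A * v z.2}.indicator (fun z => ENNReal.ofReal (z.1 ^ (q - 2))) (t, y)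
            = ENNReal.ofReal ((2 * A * v y) ^ (q - 1) / (q - 1)) := by
          have h2 : ∀ t : ℝ, {z : ℝ × ℝ | z.1 < 2 * A * v z.2}.indicator (fun z => ENNReal.ofReal (z.1 ^ (q - 2))) (t, y)
            = (Iio (2 * A * v y)).indicator (fun t => ENNReal.ofReal (t ^ (q - 2))) t := fun t => rfl
          simp_rw [h2]
          rw [setLIntegral_indicator measurableSet_Iio, Iio_inter_Ioi, restrict_Ioo_eq_restrict_Ioc]
          rw [← ofReal_integral_eq_lintegral_ofReal]
          · rw [← intervalIntegral.integral_of_le hb, integral_rpow (Or.inl (by linarith))]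
            rw [Real.zero_rpow (by linarith), show q - 2 + 1 = q - 1 by ring, sub_zero]
          · rw [← IntegrableOn, ← intervalIntegrable_iff_integrableOn_Ioc_of_le hb]
            exact intervalIntegral.intervalIntegrable_rpow' (by linarith)
          · filter_upwards [ae_restrict_mem measurableSet_Ioc] with t ht
            exact Real.rpow_nonneg ht.1.le _
        rw [h1]
        have hvy := hv0 y
        simp only [hVdef]
        rw [ENNReal.ofReal_rpow_of_nonneg hvy (by linarith), ← ENNReal.ofReal_mul hvy, ← ENNReal.ofReal_mul (div_nonneg (by positivity) (by linarith))]
        congr 1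
        rw [Real.mul_rpow (by positivity) hvy]
        rcases hvy.eq_or_lt with h0 | h0
        · rw [← h0, Real.zero_rpow (show q ≠ 0 by linarith)]; simp
        · rw [show v y ^ q = v y ^ (q - 1) * v y by rw [← Real.rpow_add_one h0.ne']; congr 1; ring]
          ring
    _ = _ := by
        rw [lintegral_const_mul _ ((hV.pow_const _).const_mul _), lintegral_const_mul _ (hV.pow_const _)]
        ring

end MpNp

namespace MpNp

theorem trig_approx (v : ℂ → ℝ) (hv : ContinuousOn v (Metric.sphere 0 1)) (δ : ℝ) (hδ : 0 < δ) :
    ∃ q : ℂ → ℂ, Differentiable ℂ q ∧ ∀ ζ ∈ Metric.sphere (0:ℂ) 1, |v ζ - (q ζ).re| ≤ δ := by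
  have : Fact ((0:ℝ) < 1) := ⟨one_pos⟩
  have hcont : Continuous fun x : AddCircle (1:ℝ) => ((v (AddCircle.toCircle x : ℂ) : ℝ) : ℂ) := by
    refine Complex.continuous_ofReal.comp (hv.comp_continuous ?_ ?_)
    · exact continuous_subtype_val.comp AddCircle.continuous_toCircle
    · intro x; simp [Circle.norm_coe]
  let V : C(AddCircle (1:ℝ), ℂ) := ⟨_, hcont⟩
  have hV : V ∈ closure ((Submodule.span ℂ (range <| @fourier (1:ℝ)) : Set C(AddCircle (1:ℝ), ℂ))) := by
    have := span_fourier_closure_eq_top (T := (1:ℝ))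
    rw [← Submodule.topologicalClosure_coe, this]; trivial
  obtain ⟨g, hg, hgV⟩ := Metric.mem_closure_iff.1 hV δ hδ
  have key : ∃ q₁ q₂ : ℂ → ℂ, Differentiable ℂ q₁ ∧ Differentiable ℂ q₂ ∧
      ∀ x : AddCircle (1:ℝ), g x = q₁ (AddCircle.toCircle x) +
        (starRingEnd ℂ) (q₂ (AddCircle.toCircle x)) := by
    refine Submodule.span_induction (p := fun g _ => ∃ q₁ q₂ : ℂ → ℂ, Differentiable ℂ q₁ ∧ Differentiable ℂ q₂ ∧
      ∀ x : AddCircle (1:ℝ), g x = q₁ (AddCircle.toCircle x) +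
        (starRingEnd ℂ) (q₂ (AddCircle.toCircle x))) ?_ ?_ ?_ ?_ hg
    · rintro _ ⟨n, rfl⟩
      obtain ⟨m, rfl | rfl⟩ := n.eq_nat_or_neg
      · refine ⟨fun z => z ^ m, 0, by fun_prop, differentiable_const 0, fun x => ?_⟩
        simp [fourier_apply, AddCircle.toCircle_nsmul]
      · refine ⟨0, fun z => z ^ m, differentiable_const 0, by fun_prop, fun x => ?_⟩
        simp [fourier_apply, AddCircle.toCircle_nsmul, AddCircle.toCircle_neg, ← Circle.coe_inv_eq_conj]
    · exact ⟨0, 0, differentiable_const 0, differentiable_const 0, fun x => by simp⟩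
    · rintro g₁ g₂ - - ⟨a, b, ha, hb, h⟩ ⟨a', b', ha', hb', h'⟩
      refine ⟨fun z => a z + a' z, fun z => b z + b' z, ha.add ha', hb.add hb', fun x => ?_⟩
      simp [h, h']; ring
    · rintro c g₁ - ⟨a, b, ha, hb, h⟩
      refine ⟨fun z => c * a z, fun z => (starRingEnd ℂ) c * b z, ha.const_mul _, hb.const_mul _, fun x => ?_⟩
      simp [h]; ring
  obtain ⟨q₁, q₂, h₁, h₂, hq⟩ := key
  refine ⟨fun z => q₁ z + q₂ z, h₁.add h₂, fun ζ hζ => ?_⟩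
  obtain ⟨x, hx⟩ := (AddCircle.homeomorphCircle (one_ne_zero : (1:ℝ) ≠ 0)).surjective ⟨ζ, by simpa [Submonoid.unitSphere] using hζ⟩
  rw [AddCircle.homeomorphCircle_apply] at hx
  have hx' : (AddCircle.toCircle x : ℂ) = ζ := by rw [hx]
  have h3 : ‖V x - g x‖ ≤ δ := by
    rw [← dist_eq_norm]; exact (ContinuousMap.dist_apply_le_dist x).trans hgV.le
  have h4 := (Complex.abs_re_le_norm _).trans h3
  rw [hq x] at h4
  simpa [V, hx'] using h4

theorem continuousOn_pk {w : ℂ} (hw : w ∈ Metric.ball (0:ℂ) 1) :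
    ContinuousOn (poissonKernel 0 w) (Metric.sphere 0 1) := by
  rw [poissonKernel_eq_re_herglotzRieszKernel]
  have := continuousOn_herglotzRieszKernel_sphere (c := 0) (R := 1) hw
  rw [abs_one] at this
  exact Complex.continuous_re.comp_continuousOn this

theorem pk_nonneg {w ζ : ℂ} (hw : w ∈ Metric.ball (0:ℂ) 1) (hζ : ζ ∈ Metric.sphere (0:ℂ) 1) :
    0 ≤ poissonKernel 0 w ζ := by
  have h1 : ‖w‖ < 1 := by simpa using hw
  have h2 : ‖ζ‖ = 1 := by simpa using hζ
  rw [poissonKernel_def]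
  simp only [sub_zero, h2]
  have : ‖w‖ ^ 2 ≤ 1 := by nlinarith [norm_nonneg w]
  exact div_nonneg (by linarith) (by positivity)

theorem poisson_re {q : ℂ → ℂ} (hq : Differentiable ℂ q) {w : ℂ} (hw : w ∈ Metric.ball (0:ℂ) 1) :
    Real.circleAverage (fun ζ => poissonKernel 0 w ζ * (q ζ).re) 0 1 = (q w).re := by
  have h := DiffContOnCl.circleAverage_poissonKernel_smul (hq.diffContOnCl (s := Metric.ball 0 1)) hw
  rw [← h]
  have hInteg : CircleIntegrable (poissonKernel 0 w • q) 0 1 :=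
    ((continuousOn_pk hw).smul hq.continuous.continuousOn).circleIntegrable zero_le_one
  rw [← Complex.reCLM_apply, ← Complex.reCLM.circleAverage_comp_comm hInteg]
  congr 1
  ext ζ
  simp

theorem log_le_poisson (F : ℂ → ℂ) (hF : DiffContOnCl ℂ F (Metric.ball 0 1)) {w : ℂ}
    (hw : w ∈ Metric.ball (0:ℂ) 1) :
    Real.log (1 + ‖F w‖) ≤
      Real.circleAverage (fun ζ => poissonKernel 0 w ζ * Real.log (1 + ‖F ζ‖)) 0 1 := by
  have hFc : ContinuousOn F (Metric.sphere 0 1) := by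
    refine hF.continuousOn.mono ?_
    rw [closure_ball _ one_ne_zero]; exact Metric.sphere_subset_closedBall
  have hv : ContinuousOn (fun ζ => Real.log (1 + ‖F ζ‖)) (Metric.sphere 0 1) :=
    (continuousOn_const.add hFc.norm).log (fun z _ => (by positivity : (0:ℝ) < 1 + ‖F z‖).ne')
  refine le_of_forall_pos_le_add fun ε hε => ?_
  obtain ⟨q, hq, hqv⟩ := trig_approx _ hv (ε/2) (by positivity)
  obtain ⟨c, hc, hcF⟩ : ∃ c : ℂ, ‖c‖ = 1 ∧ c * F w = ‖F w‖ := by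
    by_cases h0 : F w = 0
    · exact ⟨1, by simp, by simp [h0]⟩
    · have hn : (‖F w‖ : ℂ) ≠ 0 := by simpa using h0
      refine ⟨(‖F w‖ : ℂ) / F w, ?_, by field_simp⟩
      simp [h0]
  have hE : DiffContOnCl ℂ (fun z => (1 + c * F z) * Complex.exp (-q z)) (Metric.ball 0 1) := by
    have h1 : DiffContOnCl ℂ (fun z => 1 + c * F z) (Metric.ball 0 1) :=
      (hF.const_smul c).const_add 1
    have h2 : DiffContOnCl ℂ (fun z => Complex.exp (-q z)) (Metric.ball 0 1) :=
      Differentiable.diffContOnCl (by fun_prop)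
    exact h1.smul h2
  have hmax := Complex.norm_le_of_forall_mem_frontier_norm_le (C := Real.exp (ε/2)) Metric.isBounded_ball hE (fun z hz => by
    rw [frontier_ball _ one_ne_zero] at hz
    have h1 := hqv z hz
    rw [norm_mul, Complex.norm_exp]
    have h2 : ‖1 + c * F z‖ ≤ 1 + ‖F z‖ := by
      refine (norm_add_le _ _).trans ?_
      simp [hc]
    have h3 : 1 + ‖F z‖ = Real.exp (Real.log (1 + ‖F z‖)) := by rw [Real.exp_log (by positivity)]
    refine (mul_le_mul_of_nonneg_right h2 (Real.exp_pos _).le).trans ?_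
    rw [h3, ← Real.exp_add, Real.exp_le_exp]
    have := (abs_le.1 h1).2
    simp only [Complex.neg_re]; linarith) (subset_closure hw)
  have h5 : Real.log (1 + ‖F w‖) ≤ (q w).re + ε / 2 := by
    rw [norm_mul, Complex.norm_exp, hcF] at hmax
    have h6 : ‖(1:ℂ) + (‖F w‖:ℂ)‖ = 1 + ‖F w‖ := by
      rw [show (1:ℂ) + (‖F w‖:ℂ) = ((1 + ‖F w‖ : ℝ) : ℂ) by push_cast; rfl, Complex.norm_real, Real.norm_of_nonneg (by positivity)]
    rw [h6] at hmax
    rw [Real.log_le_iff_le_exp (by positivity)]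
    simp only [Complex.neg_re, Real.exp_neg] at hmax
    rw [← div_eq_mul_inv, div_le_iff₀ (Real.exp_pos _), ← Real.exp_add] at hmax
    rwa [add_comm (q w).re]
  have h1i : ∀ g : ℂ → ℝ, ContinuousOn g (Metric.sphere 0 1) → CircleIntegrable (fun ζ => poissonKernel 0 w ζ * g ζ) 0 1 :=
    fun g hg => ((continuousOn_pk hw).mul hg).circleIntegrable zero_le_one
  have h7 : (q w).re ≤ Real.circleAverage (fun ζ => poissonKernel 0 w ζ * Real.log (1 + ‖F ζ‖) + poissonKernel 0 w ζ * (ε / 2)) 0 1 := by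
    rw [← poisson_re hq hw]
    refine Real.circleAverage_mono (h1i _ (Complex.continuous_re.comp hq.continuous).continuousOn) ((h1i _ hv).add (h1i _ continuousOn_const)) ?_
    intro ζ hζ
    rw [abs_one] at hζ
    rw [← mul_add]
    refine mul_le_mul_of_nonneg_left ?_ (pk_nonneg hw hζ)
    have := (abs_le.1 (hqv ζ hζ)).1
    linarith
  rw [Real.circleAverage_fun_add (h1i _ hv) (h1i _ continuousOn_const)] at h7
  have h8 : Real.circleAverage (fun ζ => poissonKernel 0 w ζ * (ε / 2)) 0 1 = ε / 2 := by
    have := poisson_re (q := fun _ => ((ε/2 : ℝ) : ℂ)) (differentiable_const _) hw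
    simpa only [Complex.ofReal_re] using this
  linarith

end MpNp

namespace MpNp

theorem circlePt_eq (r θ : ℝ) : circlePt r θ = circleMap 0 r θ := by
  simp [circlePt, circleMap]

theorem norm_circlePt (r θ : ℝ) (hr : 0 ≤ r) : ‖circlePt r θ‖ = r := by
  simp [circlePt_eq, abs_of_nonneg hr]

theorem circlePt_mem {r : ℝ} (θ : ℝ) (hr : 0 ≤ r) (hr1 : r < 1) : circlePt r θ ∈ unitDisk := by
  simp [unitDisk, norm_circlePt r θ hr, hr1]

theorem circlePt_mul (r s θ : ℝ) : circlePt (r * s) θ = r * circlePt s θ := by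
  simp [circlePt, mul_assoc]

theorem chord_lower (r θ φ : ℝ) (hr : 0 ≤ r) (hr1 : r < 1) (ht : |φ - θ| ≤ π) :
    1 - r ≤ ‖circlePt 1 φ - circlePt r θ‖ ∧ |φ - θ| / π ≤ ‖circlePt 1 φ - circlePt r θ‖ := by
  have h1 : 1 - r ≤ ‖circlePt 1 φ - circlePt r θ‖ := by
    have := norm_sub_norm_le (circlePt 1 φ) (circlePt r θ)
    rwa [norm_circlePt _ _ zero_le_one, norm_circlePt _ _ hr] at this
  refine ⟨h1, ?_⟩
  have h2 : ‖circlePt r θ - circlePt 1 θ‖ = 1 - r := by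
    have : circlePt r θ - circlePt 1 θ = ((r - 1 : ℝ) : ℂ) * circlePt 1 θ := by
      simp [circlePt]; ring
    rw [this, norm_mul, norm_circlePt _ _ zero_le_one, Complex.norm_real, Real.norm_eq_abs, abs_of_nonpos (by linarith)]
    ring
  have h3 : ‖circlePt 1 φ - circlePt 1 θ‖ = |2 * Real.sin ((φ - θ) / 2)| := by
    have : circlePt 1 φ - circlePt 1 θ = circlePt 1 θ * (Complex.exp (Complex.I * ((φ - θ : ℝ) : ℂ)) - 1) := by
      simp only [circlePt, Complex.ofReal_one, one_mul, mul_sub, ← Complex.exp_add, mul_one]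
      congr 2; push_cast; ring
    rw [this, norm_mul, norm_circlePt _ _ zero_le_one, Complex.norm_exp_I_mul_ofReal_sub_one, one_mul, Real.norm_eq_abs]
  have h4 : ‖circlePt 1 φ - circlePt 1 θ‖ ≤ ‖circlePt 1 φ - circlePt r θ‖ + ‖circlePt r θ - circlePt 1 θ‖ := by
    have := norm_add_le (circlePt 1 φ - circlePt r θ) (circlePt r θ - circlePt 1 θ)
    simpa using this
  have h5 : 2 / π * |(φ - θ) / 2| ≤ |Real.sin ((φ - θ) / 2)| := by
    refine Real.mul_abs_le_abs_sin ?_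
    rw [abs_div, abs_two]; linarith
  rw [abs_div, abs_two] at h5
  rw [h3, abs_mul, abs_two, h2] at h4
  have h6 : 2 / π * (|φ - θ| / 2) = |φ - θ| / π := by field_simp
  rw [h6] at h5
  linarith

theorem pk_layer (r θ φ : ℝ) (hr : 0 ≤ r) (hr1 : r < 1) (ht : |φ - θ| ≤ π) :
    ∃ k : ℕ, |φ - θ| ≤ 2 ^ k * (1 - r) ∧
      poissonKernel 0 (circlePt r θ) (circlePt 1 φ) ≤ 8 * π ^ 2 / 4 ^ k / (1 - r) := by
  classical
  set δ := 1 - r with hδ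
  have hδ0 : 0 < δ := by linarith
  obtain ⟨h1, h2⟩ := chord_lower r θ φ hr hr1 ht
  set D := ‖circlePt 1 φ - circlePt r θ‖ with hD
  have hpk : poissonKernel 0 (circlePt r θ) (circlePt 1 φ) = (1 - r ^ 2) / D ^ 2 := by
    rw [poissonKernel_def]
    simp only [sub_zero, norm_circlePt _ _ zero_le_one, norm_circlePt _ _ hr, one_pow]
    rfl
  have hex : ∃ k : ℕ, |φ - θ| ≤ 2 ^ k * δ := by
    obtain ⟨k, hk⟩ := pow_unbounded_of_one_lt (|φ - θ| / δ) (one_lt_two)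
    exact ⟨k, by rw [div_lt_iff₀ hδ0] at hk; exact hk.le⟩
  refine ⟨Nat.find hex, Nat.find_spec hex, ?_⟩
  have hDpos : 0 < D := by linarith
  have hπ := Real.pi_gt_three
  have hlow : 2 ^ (Nat.find hex) * δ / (2 * π) ≤ D := by
    rcases Nat.eq_zero_or_pos (Nat.find hex) with h0 | h0
    · rw [h0, pow_zero, one_mul]
      refine le_trans ?_ h1
      rw [div_le_iff₀ (by positivity)]; nlinarith
    · have := Nat.find_min hex (m := Nat.find hex - 1) (by omega)
      push Not at this
      refine le_trans ?_ h2
      have h3 : (2:ℝ) ^ (Nat.find hex) = 2 * 2 ^ (Nat.find hex - 1) := by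
        rw [← pow_succ']; congr 1; omega
      rw [h3, div_le_div_iff₀ (by positivity) (by positivity)]
      nlinarith
  rw [hpk, div_le_iff₀ (by positivity)]
  set K : ℝ := 2 ^ (Nat.find hex) with hK
  have hK0 : 0 < K := by positivity
  have h4 : (4:ℝ) ^ (Nat.find hex) = K ^ 2 := by
    rw [hK, ← pow_mul, mul_comm, pow_mul]; norm_num
  rw [h4]
  have h5 : (K * δ / (2 * π)) ^ 2 ≤ D ^ 2 := by gcongr
  calc 1 - r ^ 2 ≤ 2 * δ := by nlinarith
    _ = 8 * π ^ 2 / K ^ 2 / δ * (K * δ / (2 * π)) ^ 2 := by field_simp; norm_num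
    _ ≤ _ := by gcongr

theorem poisson_le_mhl (v : ℝ → ℝ) (hv : Continuous v) (hv0 : ∀ x, 0 ≤ v x) (r θ : ℝ)
    (hr : 0 ≤ r) (hr1 : r < 1) (hθ : θ ∈ Ioc 0 (2 * π)) :
    ∫⁻ φ in Ioc (θ - π) (θ + π), ENNReal.ofReal (poissonKernel 0 (circlePt r θ) (circlePt 1 φ) * v φ) ≤
      ENNReal.ofReal (32 * π ^ 2) * mhl (fun y => ENNReal.ofReal ((Icc (-2 * π) (4 * π)).indicator v y)) θ := by
  set V : ℝ → ℝ≥0∞ := fun y => ENNReal.ofReal ((Icc (-2 * π) (4 * π)).indicator v y) with hV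
  set δ := 1 - r with hδ
  have hδ0 : 0 < δ := by linarith
  have hVm : Measurable V := (hv.measurable.indicator measurableSet_Icc).ennreal_ofReal
  have hπ := Real.pi_pos
  have hstep : ∀ φ ∈ Ioc (θ - π) (θ + π),
      ENNReal.ofReal (poissonKernel 0 (circlePt r θ) (circlePt 1 φ) * v φ) ≤
        ∑' k : ℕ, ENNReal.ofReal (8 * π ^ 2 / 4 ^ k / δ) *
          (Metric.closedBall θ (2 ^ k * δ)).indicator V φ := by
    intro φ hφ
    have ht : |φ - θ| ≤ π := abs_le.2 ⟨by linarith [hφ.1], by linarith [hφ.2]⟩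
    obtain ⟨k, hk, hp⟩ := pk_layer r θ φ hr hr1 ht
    refine le_trans ?_ (ENNReal.le_tsum k)
    have hmem : φ ∈ Metric.closedBall θ (2 ^ k * δ) := by
      rw [Metric.mem_closedBall, Real.dist_eq]; exact hk
    have hmem2 : φ ∈ Icc (-2 * π) (4 * π) := by
      constructor <;> linarith [hφ.1, hφ.2, hθ.1, hθ.2]
    rw [indicator_of_mem hmem]
    simp only [hV, indicator_of_mem hmem2]
    rw [← ENNReal.ofReal_mul (by positivity)]
    exact ENNReal.ofReal_le_ofReal (mul_le_mul_of_nonneg_right hp (hv0 _))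
  calc _ ≤ ∫⁻ φ in Ioc (θ - π) (θ + π), ∑' k : ℕ, ENNReal.ofReal (8 * π ^ 2 / 4 ^ k / δ) *
          (Metric.closedBall θ (2 ^ k * δ)).indicator V φ :=
        setLIntegral_mono' measurableSet_Ioc hstep
    _ ≤ ∫⁻ φ, ∑' k : ℕ, ENNReal.ofReal (8 * π ^ 2 / 4 ^ k / δ) *
          (Metric.closedBall θ (2 ^ k * δ)).indicator V φ := setLIntegral_le_lintegral _ _
    _ = ∑' k : ℕ, ENNReal.ofReal (8 * π ^ 2 / 4 ^ k / δ) * ∫⁻ φ in Metric.closedBall θ (2 ^ k * δ), V φ := by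
        rw [lintegral_tsum]
        · refine tsum_congr fun k => ?_
          rw [lintegral_const_mul _ (hVm.indicator Metric.isClosed_closedBall.measurableSet),
            lintegral_indicator Metric.isClosed_closedBall.measurableSet]
        · intro k
          exact (measurable_const.mul (hVm.indicator Metric.isClosed_closedBall.measurableSet)).aemeasurable
    _ ≤ ∑' k : ℕ, ENNReal.ofReal (16 * π ^ 2 * (1/2) ^ k) * mhl V θ := by
        refine ENNReal.tsum_le_tsum fun k => ?_
        have hs : 0 < 2 ^ k * δ := by positivity
        have h1 : (∫⁻ y in Metric.closedBall θ (2 ^ k * δ), V y) / ENNReal.ofReal (2 * (2 ^ k * δ)) ≤ mhl V θ :=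
          le_iSup₂ (f := fun s (_ : s ∈ Ioi (0:ℝ)) => (∫⁻ y in Metric.closedBall θ s, V y) / ENNReal.ofReal (2 * s)) (2 ^ k * δ) hs
        rw [ENNReal.div_le_iff (by simpa using hs) ENNReal.ofReal_ne_top] at h1
        refine (mul_le_mul_right h1 _).trans_eq ?_
        rw [mul_comm (mhl V θ), ← mul_assoc, ← ENNReal.ofReal_mul (by positivity)]
        congr 2
        rw [show (4:ℝ) ^ k = 2 ^ k * 2 ^ k by rw [← mul_pow]; norm_num, one_div, inv_pow]
        field_simp
        norm_num
    _ = _ := by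
        rw [ENNReal.tsum_mul_right, ← ENNReal.ofReal_tsum_of_nonneg (fun k => by positivity)
          (summable_geometric_two.mul_left _), tsum_mul_left, tsum_geometric_two]
        congr 2; ring

end MpNp

namespace MpNp

theorem circlePt_periodic (r : ℝ) : Function.Periodic (circlePt r) (2 * π) := by
  intro θ; simp [circlePt_eq, periodic_circleMap 0 r θ]

theorem continuous_circlePt (r : ℝ) : Continuous (circlePt r) := by
  unfold circlePt; fun_prop

theorem setLIntegral_shift (g : ℝ → ℝ≥0∞) (T : ℝ) (hg : Function.Periodic g T) (a b : ℝ) :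
    ∫⁻ x in Ioc (a + T) (b + T), g x = ∫⁻ x in Ioc a b, g x := by
  have h := (measurePreserving_add_right (volume : Measure ℝ) T).setLIntegral_comp_preimage_emb
    (MeasurableEquiv.addRight T).measurableEmbedding g (Ioc (a + T) (b + T))
  rw [← h]
  have : (fun x => x + T) ⁻¹' Ioc (a + T) (b + T) = Ioc a b := by ext; simp
  rw [this]
  exact lintegral_congr fun x => by rw [hg x]

theorem three_periods (g : ℝ → ℝ≥0∞) (hg : Function.Periodic g (2 * π)) :
    ∫⁻ x in Icc (-2 * π) (4 * π), g x ≤ 3 * ∫⁻ x in Ioc 0 (2 * π), g x := by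
  have hπ := Real.pi_pos
  have h1 := setLIntegral_shift g (2 * π) hg (-2 * π) 0
  have h2 := setLIntegral_shift g (2 * π) hg 0 (2 * π)
  rw [show -2 * π + 2 * π = 0 by ring, zero_add] at h1
  rw [show 2 * π + 2 * π = 4 * π by ring, zero_add] at h2
  rw [setLIntegral_congr (Ioc_ae_eq_Icc (μ := volume)).symm]
  have h3 : Ioc (-2 * π) (4 * π) ⊆ (Ioc (-2*π) 0 ∪ Ioc 0 (2 * π)) ∪ Ioc (2 * π) (4 * π) := by
    rw [Ioc_union_Ioc_eq_Ioc (by linarith) (by linarith), Ioc_union_Ioc_eq_Ioc (by linarith) (by linarith)]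
  refine (lintegral_mono_set h3).trans ((lintegral_union_le _ _ _).trans
    ((add_le_add_left (lintegral_union_le _ _ _) _).trans_eq ?_))
  rw [h2, h1]; ring

/-- The maximal function of `log (1+|F|)`. -/
def wmax (F : ℂ → ℂ) (θ : ℝ) : ℝ≥0∞ :=
  ⨆ r ∈ Ico (0:ℝ) 1, ENNReal.ofReal (Real.log (1 + ‖F (circlePt r θ)‖))

theorem continuous_log_comp (f : ℂ → ℂ) (hf : ContinuousOn f unitDisk) (r : ℝ) (hr : 0 ≤ r) (hr1 : r < 1) :
    Continuous fun θ => Real.log (1 + ‖f (circlePt r θ)‖) := by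
  have h : Continuous fun θ => f (circlePt r θ) :=
    hf.comp_continuous (continuous_circlePt r) fun θ => circlePt_mem θ hr hr1
  refine Continuous.log (continuous_const.add h.norm) fun θ => ?_
  positivity

theorem measurable_wmax (f : ℂ → ℂ) (hf : ContinuousOn f unitDisk) : Measurable (wmax f) := by
  have : LowerSemicontinuous (wmax f) := by
    refine lowerSemicontinuous_biSup fun r hr => Continuous.lowerSemicontinuous ?_
    exact ENNReal.continuous_ofReal.comp (continuous_log_comp f hf r hr.1 hr.2)
  exact this.measurable

theorem log_le_mhl (F : ℂ → ℂ) (hF : DiffContOnCl ℂ F (Metric.ball 0 1)) (r θ : ℝ)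
    (hr : 0 ≤ r) (hr1 : r < 1) (hθ : θ ∈ Ioc 0 (2 * π))
    (hFc : Continuous fun φ => Real.log (1 + ‖F (circlePt 1 φ)‖)) :
    ENNReal.ofReal (Real.log (1 + ‖F (circlePt r θ)‖)) ≤
      ENNReal.ofReal (16 * π) * mhl (fun y => ENNReal.ofReal ((Icc (-2 * π) (4 * π)).indicator
        (fun φ => Real.log (1 + ‖F (circlePt 1 φ)‖)) y)) θ := by
  set v : ℝ → ℝ := fun φ => Real.log (1 + ‖F (circlePt 1 φ)‖) with hv
  have hv0 : ∀ x, 0 ≤ v x := fun x => Real.log_nonneg (by simp)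
  have hπ := Real.pi_pos
  have hw : circlePt r θ ∈ Metric.ball (0:ℂ) 1 := circlePt_mem θ hr hr1
  have h1 := log_le_poisson F hF hw
  have hpc : Continuous fun φ => poissonKernel 0 (circlePt r θ) (circlePt 1 φ) :=
    (continuousOn_pk hw).comp_continuous (continuous_circlePt 1) fun φ => by
      simp [norm_circlePt 1 φ zero_le_one]
  have hp0 : ∀ φ, 0 ≤ poissonKernel 0 (circlePt r θ) (circlePt 1 φ) := fun φ =>
    pk_nonneg hw (by simp [norm_circlePt 1 φ zero_le_one])
  set G : ℝ → ℝ := fun φ => poissonKernel 0 (circlePt r θ) (circlePt 1 φ) * v φ with hG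
  have hGc : Continuous G := hpc.mul hFc
  have hGp : Function.Periodic G (2 * π) := fun φ => by
    simp only [hG, hv, circlePt_periodic 1 φ]
  have h2 : Real.circleAverage (fun ζ => poissonKernel 0 (circlePt r θ) ζ * Real.log (1 + ‖F ζ‖)) 0 1 =
      (2 * π)⁻¹ * ∫ φ in Ioc (θ - π) (θ + π), G φ := by
    rw [Real.circleAverage_def, smul_eq_mul]
    congr 1
    have := hGp.intervalIntegral_add_eq 0 (θ - π)
    rw [zero_add, show θ - π + 2 * π = θ + π by ring] at this
    rw [← intervalIntegral.integral_of_le (by linarith), ← this]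
    simp only [hG, hv, circlePt_eq]
  rw [h2] at h1
  refine (ENNReal.ofReal_le_ofReal h1).trans ?_
  rw [ENNReal.ofReal_mul (by positivity), ofReal_integral_eq_lintegral_ofReal hGc.integrableOn_Ioc
    (Eventually.of_forall fun φ => mul_nonneg (hp0 φ) (hv0 φ))]
  refine (mul_le_mul_right (poisson_le_mhl v hFc hv0 r θ hr hr1 hθ) _).trans_eq ?_
  rw [← mul_assoc, ← ENNReal.ofReal_mul (by positivity)]
  congr 2
  field_simp; norm_num

theorem T0 (q : ℝ) (hq : 1 < q) : ∃ C : ℝ≥0∞, C ≠ ∞ ∧ ∀ F : ℂ → ℂ,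
    DiffContOnCl ℂ F (Metric.ball 0 1) →
    ∫⁻ θ in Ioc 0 (2 * π), wmax F θ ^ q ≤
      C * ∫⁻ θ in Ioc 0 (2 * π), ENNReal.ofReal (Real.log (1 + ‖F (circlePt 1 θ)‖)) ^ q := by
  obtain ⟨C, hC, hst⟩ := strong_type q (16 * π) hq (by positivity)
  refine ⟨C * 3, by finiteness, fun F hF => ?_⟩
  have hFcl : ContinuousOn F (Metric.closedBall 0 1) := by
    have := hF.continuousOn; rwa [closure_ball _ one_ne_zero] at this
  obtain ⟨B, hB⟩ := (isCompact_closedBall (0:ℂ) 1).exists_bound_of_continuousOn hFcl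
  have hFc : Continuous fun φ => Real.log (1 + ‖F (circlePt 1 φ)‖) := by
    have h : Continuous fun θ => F (circlePt 1 θ) :=
      hFcl.comp_continuous (continuous_circlePt 1) fun θ => by simp [norm_circlePt 1 θ zero_le_one]
    exact Continuous.log (continuous_const.add h.norm) fun θ => by positivity
  have hfin : ∀ θ, wmax F θ ≠ ∞ := by
    intro θ
    refine ne_top_of_le_ne_top (ENNReal.ofReal_ne_top (r := Real.log (1 + B))) ?_
    refine iSup₂_le fun r hr => ENNReal.ofReal_le_ofReal (Real.log_le_log (by positivity) ?_)
    have := hB (circlePt r θ) (by simp [norm_circlePt r θ hr.1, hr.2.le])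
    linarith
  have hmeas : Measurable (wmax F) := measurable_wmax F (hFcl.mono Metric.ball_subset_closedBall)
  set v : ℝ → ℝ := fun φ => Real.log (1 + ‖F (circlePt 1 φ)‖) with hv
  have hv0 : ∀ x, 0 ≤ v x := fun x => Real.log_nonneg (by simp)
  have h := hst ((Icc (-2 * π) (4 * π)).indicator v) (fun θ => (wmax F θ).toReal) (Ioc 0 (2 * π))
    (hFc.measurable.indicator measurableSet_Icc) (fun y => indicator_nonneg (fun x _ => hv0 x) y)
    measurableSet_Ioc hmeas.ennreal_toReal (fun x => ENNReal.toReal_nonneg) (fun θ hθ => by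
      rw [ENNReal.ofReal_toReal (hfin θ)]
      exact iSup₂_le fun r hr => log_le_mhl F hF r θ hr.1 hr.2 hθ hFc)
  simp only [ENNReal.ofReal_toReal (hfin _)] at h
  refine h.trans ?_
  rw [mul_assoc]
  refine mul_le_mul_right ?_ _
  have h2 : ∀ y, ENNReal.ofReal ((Icc (-2 * π) (4 * π)).indicator v y) ^ q =
      (Icc (-2 * π) (4 * π)).indicator (fun y => ENNReal.ofReal (v y) ^ q) y := by
    intro y
    by_cases hy : y ∈ Icc (-2 * π) (4 * π)
    · simp only [indicator_of_mem hy]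
    · simp only [indicator_of_notMem hy, ENNReal.ofReal_zero]
      exact ENNReal.zero_rpow_of_pos (by linarith)
  simp_rw [h2]
  rw [lintegral_indicator measurableSet_Icc]
  exact three_periods _ fun φ => by simp only [hv, circlePt_periodic 1 φ]

theorem elog1p_le_iff {x b : ℝ≥0∞} (hb : b ≠ ∞) :
    elog1p x ≤ b ↔ x ≤ ENNReal.ofReal (Real.exp b.toReal - 1) := by
  unfold elog1p
  split_ifs with h
  · simp [h, hb]
  · rw [ENNReal.ofReal_le_iff_le_toReal hb, Real.log_le_iff_le_exp (by positivity),
      ← ENNReal.toReal_le_toReal h ENNReal.ofReal_ne_top, ENNReal.toReal_ofReal]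
    · constructor <;> intro _ <;> linarith
    · simp

theorem elog1p_coe (z : ℂ) : elog1p (‖z‖₊ : ℝ≥0∞) = ENNReal.ofReal (Real.log (1 + ‖z‖)) := by
  simp [elog1p]

theorem elog1p_maxRad (f : ℂ → ℂ) (θ : ℝ) : elog1p (maxRad f θ) = wmax f θ := by
  have hiff : ∀ b : ℝ≥0∞, b ≠ ∞ → (elog1p (maxRad f θ) ≤ b ↔ wmax f θ ≤ b) := by
    intro b hb
    rw [elog1p_le_iff hb, maxRad, wmax, iSup₂_le_iff, iSup₂_le_iff]
    refine forall₂_congr fun r hr => ?_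
    rw [← elog1p_le_iff hb, elog1p_coe]
  apply le_antisymm
  · by_cases h : wmax f θ = ∞
    · simp [h]
    · exact (hiff _ h).2 le_rfl
  · by_cases h : elog1p (maxRad f θ) = ∞
    · simp [h]
    · exact (hiff _ h).1 le_rfl

theorem T (q : ℝ) (hq : 1 < q) : ∃ C : ℝ≥0∞, C ≠ ∞ ∧ ∀ (f : ℂ → ℂ) (R : ℕ → ℝ),
    DifferentiableOn ℂ f unitDisk → (∀ n, R n ∈ Ioo 0 1) → Tendsto R atTop (𝓝 1) →
    ∫⁻ θ in Ioc 0 (2 * π), wmax f θ ^ q ≤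
      liminf (fun n => C * ∫⁻ θ in Ioc 0 (2 * π),
        ENNReal.ofReal (Real.log (1 + ‖f (circlePt (R n) θ)‖)) ^ q) atTop := by
  obtain ⟨C, hC, hT⟩ := T0 q hq
  refine ⟨C, hC, fun f R hf hR hR1 => ?_⟩
  have hq0 : 0 < q := by linarith
  set F : ℕ → ℂ → ℂ := fun n z => f ((R n : ℂ) * z) with hFdef
  have hmaps : ∀ n, MapsTo (fun z : ℂ => (R n : ℂ) * z) (Metric.closedBall 0 1) unitDisk := by
    intro n z hz
    have hz' : ‖z‖ ≤ 1 := by simpa using hz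
    have := (hR n).1; have := (hR n).2
    simp only [unitDisk, Metric.mem_ball, dist_zero_right, norm_mul, Complex.norm_real, Real.norm_eq_abs, abs_of_pos (hR n).1]
    nlinarith [norm_nonneg z]
  have hF : ∀ n, DiffContOnCl ℂ (F n) (Metric.ball 0 1) := by
    intro n
    refine DifferentiableOn.diffContOnCl ?_
    rw [closure_ball _ one_ne_zero]
    exact hf.comp (by fun_prop) (hmaps n)
  have hmeas : ∀ n, Measurable (wmax (F n)) := fun n => measurable_wmax _ (hF n).differentiableOn.continuousOn
  have hle : ∀ θ, wmax f θ ≤ liminf (fun n => wmax (F n) θ) atTop := by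
    intro θ
    refine iSup₂_le fun r hr => le_liminf_of_le (by isBoundedDefault) ?_
    filter_upwards [hR1.eventually (lt_mem_nhds hr.2)] with n hn
    have hRn := (hR n).1
    have hmem : r / R n ∈ Ico (0:ℝ) 1 := ⟨div_nonneg hr.1 hRn.le, (div_lt_one hRn).2 hn⟩
    refine le_trans (le_of_eq ?_) (le_iSup₂ (f := fun s (_ : s ∈ Ico (0:ℝ) 1) => ENNReal.ofReal (Real.log (1 + ‖F n (circlePt s θ)‖))) (r / R n) hmem)
    simp only [hFdef, ← circlePt_mul]
    rw [mul_div_cancel₀ _ hRn.ne']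
  calc ∫⁻ θ in Ioc 0 (2 * π), wmax f θ ^ q
      ≤ ∫⁻ θ in Ioc 0 (2 * π), liminf (fun n => wmax (F n) θ ^ q) atTop := by
        refine lintegral_mono fun θ => ?_
        have := (ENNReal.orderIsoRpow q hq0).liminf_apply (u := fun n => wmax (F n) θ) (f := atTop)
          (by isBoundedDefault) (by isBoundedDefault) (by isBoundedDefault) (by isBoundedDefault)
        simp only [ENNReal.orderIsoRpow_apply] at this
        rw [← this]
        exact ENNReal.rpow_le_rpow (hle θ) hq0.le
    _ ≤ liminf (fun n => ∫⁻ θ in Ioc 0 (2 * π), wmax (F n) θ ^ q) atTop :=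
        lintegral_liminf_le fun n => (hmeas n).pow_const _
    _ ≤ _ := by
        refine liminf_le_liminf (Eventually.of_forall fun n => ?_)
        refine (hT (F n) (hF n)).trans_eq ?_
        simp only [hFdef, ← circlePt_mul, mul_one]

end MpNp

namespace MpNp

theorem log1p_le (x : ℝ) (hx : 0 ≤ x) :
    ENNReal.ofReal (Real.log (1 + x)) ≤ ENNReal.ofReal (Real.log 2) + ENNReal.ofReal (Real.log x) := by
  rcases le_total x 1 with h | h
  · exact le_add_right (ENNReal.ofReal_le_ofReal (Real.log_le_log (by linarith) (by linarith)))
  · rw [← ENNReal.ofReal_add (Real.log_nonneg (by norm_num)) (Real.log_nonneg h),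
      ← Real.log_mul (by norm_num) (by linarith)]
    exact ENNReal.ofReal_le_ofReal (Real.log_le_log (by linarith) (by linarith))

theorem log_le_log1p (x : ℝ) (hx : 0 ≤ x) :
    ENNReal.ofReal (Real.log x) ≤ ENNReal.ofReal (Real.log (1 + x)) := by
  rcases hx.eq_or_lt with h | h
  · simp [← h]
  · exact ENNReal.ofReal_le_ofReal (Real.log_le_log h (by linarith))

theorem elog1p_le (x : ℝ≥0∞) : elog1p x ≤ ENNReal.ofReal (Real.log 2) + elogPlus x := by
  unfold elog1p elogPlus
  split_ifs with h
  · simp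
  · exact log1p_le _ ENNReal.toReal_nonneg

theorem elogPlus_le (x : ℝ≥0∞) : elogPlus x ≤ elog1p x := by
  unfold elog1p elogPlus
  split_ifs with h
  · simp
  · exact log_le_log1p _ ENNReal.toReal_nonneg

theorem int_add_const (p : ℝ) (hp : 1 < p) (g : ℝ → ℝ≥0∞) :
    ∫⁻ θ in Ioc 0 (2 * π), (ENNReal.ofReal (Real.log 2) + g θ) ^ p ≤
      2 ^ (p - 1) * (ENNReal.ofReal (Real.log 2) ^ p * ENNReal.ofReal (2 * π) + ∫⁻ θ in Ioc 0 (2 * π), g θ ^ p) := by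
  calc _ ≤ ∫⁻ θ in Ioc 0 (2 * π), 2 ^ (p - 1) * (ENNReal.ofReal (Real.log 2) ^ p + g θ ^ p) :=
        lintegral_mono fun θ => ENNReal.rpow_add_le_mul_rpow_add_rpow _ _ hp.le
    _ = _ := by
        rw [lintegral_const_mul' _ _ (ENNReal.rpow_ne_top_of_nonneg (by linarith) (by norm_num)),
          lintegral_add_left measurable_const, setLIntegral_const]
        simp

theorem fin_bound (p : ℝ) (hp : 1 < p) {B : ℝ≥0∞} (hB : B ≠ ∞) :
    2 ^ (p - 1) * (ENNReal.ofReal (Real.log 2) ^ p * ENNReal.ofReal (2 * π) + B) ≠ ∞ := by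
  refine ENNReal.mul_ne_top (ENNReal.rpow_ne_top_of_nonneg (by linarith) (by norm_num)) ?_
  refine ENNReal.add_ne_top.2 ⟨ENNReal.mul_ne_top (ENNReal.rpow_ne_top_of_nonneg (by linarith) ENNReal.ofReal_ne_top) ENNReal.ofReal_ne_top, hB⟩

theorem div_lt_top_iff (x : ℝ≥0∞) : x / ENNReal.ofReal (2 * π) < ∞ ↔ x < ∞ := by
  constructor
  · intro h
    by_contra hx
    rw [not_lt, top_le_iff] at hx
    rw [hx, ENNReal.top_div_of_ne_top ENNReal.ofReal_ne_top] at h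
    exact lt_irrefl _ h
  · intro h
    exact ENNReal.div_lt_top h.ne (by simpa using Real.pi_pos)

theorem mem_Mp_iff (p : ℝ) (hp : 1 < p) (f : ℂ → ℂ) :
    f ∈ MpClass p ↔ DifferentiableOn ℂ f unitDisk ∧ ∫⁻ θ in Ioc 0 (2 * π), wmax f θ ^ p < ∞ := by
  have hp0 : 0 ≤ p := by linarith
  simp only [MpClass, Set.mem_ofPred_eq, div_lt_top_iff]
  refine and_congr_right fun hf => ⟨fun h => ?_, fun h => ?_⟩
  · refine lt_of_le_of_lt ?_ (fin_bound p hp h.ne).lt_top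
    refine le_trans (lintegral_mono fun θ => ?_) (int_add_const p hp _)
    rw [← elog1p_maxRad]
    exact ENNReal.rpow_le_rpow (elog1p_le _) hp0
  · refine lt_of_le_of_lt (lintegral_mono fun θ => ?_) h
    rw [← elog1p_maxRad]
    exact ENNReal.rpow_le_rpow (elogPlus_le _) hp0

theorem le_wmax (f : ℂ → ℂ) (θ r : ℝ) (hr : r ∈ Ico (0:ℝ) 1) :
    ENNReal.ofReal (Real.log (1 + ‖f (circlePt r θ)‖)) ≤ wmax f θ :=
  le_iSup₂ (f := fun s (_ : s ∈ Ico (0:ℝ) 1) => ENNReal.ofReal (Real.log (1 + ‖f (circlePt s θ)‖))) r hr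

/-- A standard sequence of radii. -/
def rad (n : ℕ) : ℝ := 1 - 1 / ((n : ℝ) + 2)

theorem rad_mem (n : ℕ) : rad n ∈ Ioo (0:ℝ) 1 := by
  have h : (0:ℝ) < (n:ℝ) + 2 := by positivity
  have h2 : 1 / ((n:ℝ) + 2) < 1 := by rw [div_lt_one h]; have : (0:ℝ) ≤ n := by positivity
                                      linarith
  have h3 : 0 < 1 / ((n:ℝ) + 2) := by positivity
  constructor <;> simp only [rad] <;> linarith

theorem rad_tendsto : Tendsto rad atTop (𝓝 1) := by
  have h := (tendsto_const_div_atTop_nhds_zero_nat (1:ℝ)).comp (tendsto_add_atTop_nat 2)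
  have h2 := (tendsto_const_nhds (x := (1:ℝ))).sub h
  rw [sub_zero] at h2
  refine h2.congr fun n => ?_
  simp [rad]

theorem rad_tendsto' : Tendsto rad atTop (𝓝[<] 1) :=
  tendsto_nhdsWithin_iff.2 ⟨rad_tendsto, Eventually.of_forall fun n => (rad_mem n).2⟩

theorem Np_bound (p : ℝ) (hp : 1 < p) (f : ℂ → ℂ) (hf : f ∈ NpClass p) :
    ∃ B : ℝ≥0∞, B ≠ ∞ ∧ ∀ r ∈ Ico (0:ℝ) 1,
      ∫⁻ θ in Ioc 0 (2 * π), ENNReal.ofReal (Real.log (1 + ‖f (circlePt r θ)‖)) ^ p ≤ B := by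
  obtain ⟨hf1, hf2⟩ := hf
  set S := (⨆ r ∈ Set.Ico (0 : ℝ) 1,
      (∫⁻ θ in Set.Ioc 0 (2 * π),
        ENNReal.ofReal (Real.log ‖f (circlePt r θ)‖) ^ p) / ENNReal.ofReal (2 * π)) with hS
  have hSB : S * ENNReal.ofReal (2 * π) ≠ ∞ := ENNReal.mul_ne_top hf2.ne ENNReal.ofReal_ne_top
  refine ⟨_, fin_bound p hp hSB, fun r hr => ?_⟩
  have h1 : (∫⁻ θ in Set.Ioc 0 (2 * π),
        ENNReal.ofReal (Real.log ‖f (circlePt r θ)‖) ^ p) / ENNReal.ofReal (2 * π) ≤ S :=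
    le_iSup₂ (f := fun r (_ : r ∈ Ico (0:ℝ) 1) => (∫⁻ θ in Set.Ioc 0 (2 * π),
        ENNReal.ofReal (Real.log ‖f (circlePt r θ)‖) ^ p) / ENNReal.ofReal (2 * π)) r hr
  rw [ENNReal.div_le_iff (by simpa using Real.pi_pos) ENNReal.ofReal_ne_top] at h1
  refine le_trans ?_ ((int_add_const p hp fun θ => ENNReal.ofReal (Real.log ‖f (circlePt r θ)‖)).trans ?_)
  · exact lintegral_mono fun θ => ENNReal.rpow_le_rpow (log1p_le _ (norm_nonneg _)) (by linarith)
  · gcongr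

theorem Mp_eq_Np (p : ℝ) (hp : 1 < p) : MpClass p = NpClass p := by
  ext f
  constructor
  · intro h
    rw [mem_Mp_iff p hp] at h
    refine ⟨h.1, ?_⟩
    refine lt_of_le_of_lt ?_ ((div_lt_top_iff _).2 h.2)
    refine iSup₂_le fun r hr => ENNReal.div_le_div_right (lintegral_mono fun θ => ?_) _
    exact ENNReal.rpow_le_rpow ((log_le_log1p _ (norm_nonneg _)).trans (le_wmax f θ r hr)) (by linarith)
  · intro h
    rw [mem_Mp_iff p hp]
    refine ⟨h.1, ?_⟩
    obtain ⟨B, hB, hBr⟩ := Np_bound p hp f h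
    obtain ⟨C, hC, hT⟩ := T p hp
    refine lt_of_le_of_lt (hT f rad h.1 rad_mem rad_tendsto) ?_
    refine lt_of_le_of_lt ?_ (ENNReal.mul_ne_top hC hB).lt_top
    refine (liminf_le_liminf (v := fun _ => C * B) (Eventually.of_forall fun n => ?_)).trans_eq (liminf_const _)
    exact mul_le_mul_right (hBr _ ⟨(rad_mem n).1.le, (rad_mem n).2⟩) _

end MpNp

namespace MpNp

theorem orth (m n : ℕ) : ∫ θ in (0:ℝ)..(2 * π), (starRingEnd ℂ) (circlePt 1 θ ^ m) * circlePt 1 θ ^ n =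
    if n = m then (2 * π : ℂ) else 0 := by
  have h : ∀ θ : ℝ, (starRingEnd ℂ) (circlePt 1 θ ^ m) * circlePt 1 θ ^ n =
      Complex.exp ((((n:ℤ) - (m:ℤ) : ℤ) : ℂ) * Complex.I * θ) := by
    intro θ
    simp only [circlePt, Complex.ofReal_one, one_mul, ← Complex.exp_conj, map_mul,
      Complex.conj_ofReal, Complex.conj_I, map_natCast, ← Complex.exp_nat_mul, ← Complex.exp_add]
    congr 1; push_cast; ring
  simp_rw [h]
  split_ifs with hnm
  · subst hnm; simp
  · have hne : ((((n:ℤ) - (m:ℤ) : ℤ) : ℂ) * Complex.I) ≠ 0 := by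
      refine mul_ne_zero ?_ Complex.I_ne_zero
      rw [Int.cast_ne_zero]
      omega
    rw [integral_exp_mul_complex hne]
    have h2 : (((n:ℤ) - (m:ℤ) : ℤ) : ℂ) * Complex.I * ((2 * π : ℝ) : ℂ) =
        (((n:ℤ) - (m:ℤ) : ℤ) : ℂ) * (2 * π * Complex.I) := by push_cast; ring
    rw [h2, Complex.exp_int_mul_two_pi_mul_I]
    simp

theorem norm_one_pow (θ : ℝ) (n : ℕ) : ‖circlePt 1 θ ^ n‖ = 1 := by
  rw [norm_pow, norm_circlePt _ _ zero_le_one, one_pow]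

theorem hasSum_int (c : ℕ → ℂ) (hc : Summable fun n => ‖c n‖) (u : ℝ → ℂ) (hu : Continuous u) (M : ℝ)
    (hM : ∀ θ, ‖u θ‖ ≤ M) :
    HasSum (fun n => ∫ θ in (0:ℝ)..(2 * π), u θ * (c n * circlePt 1 θ ^ n))
      (∫ θ in (0:ℝ)..(2 * π), u θ * ∑' n, c n * circlePt 1 θ ^ n) := by
  have hcp := continuous_circlePt 1
  refine intervalIntegral.hasSum_integral_of_dominated_convergence (fun n _ => M * ‖c n‖)
    (fun n => (by fun_prop : Continuous fun θ => u θ * (c n * circlePt 1 θ ^ n)).aestronglyMeasurable) (fun n => Eventually.of_forall fun θ _ => ?_)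
    (Eventually.of_forall fun θ _ => hc.mul_left M) (by simp) (Eventually.of_forall fun θ _ => ?_)
  · rw [norm_mul, norm_mul, norm_one_pow, mul_one]
    exact mul_le_mul_of_nonneg_right (hM θ) (norm_nonneg _)
  · refine HasSum.mul_left _ (Summable.hasSum ?_)
    refine Summable.of_norm ?_
    simpa only [norm_mul, norm_one_pow, mul_one] using hc

theorem parseval (c : ℕ → ℂ) (hc : Summable fun n => ‖c n‖) :
    HasSum (fun n => 2 * π * ‖c n‖ ^ 2)
      (∫ θ in (0:ℝ)..(2 * π), ‖∑' n, c n * circlePt 1 θ ^ n‖ ^ 2) := by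
  have hcp := continuous_circlePt 1
  set S : ℝ → ℂ := fun θ => ∑' n, c n * circlePt 1 θ ^ n with hS
  have hSc : Continuous S := by
    refine continuous_tsum (fun n => by fun_prop) hc fun n θ => ?_
    rw [norm_mul, norm_one_pow, mul_one]
  have hSb : ∀ θ, ‖S θ‖ ≤ ∑' n, ‖c n‖ := by
    intro θ
    refine tsum_of_norm_bounded hc.hasSum fun n => ?_
    rw [norm_mul, norm_one_pow, mul_one]
  have hA : ∀ m, ∫ θ in (0:ℝ)..(2 * π), (starRingEnd ℂ) (circlePt 1 θ ^ m) * S θ = 2 * π * c m := by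
    intro m
    have h1 := hasSum_int c hc (fun θ => (starRingEnd ℂ) (circlePt 1 θ ^ m)) (by fun_prop) 1
      (fun θ => by rw [RCLike.norm_conj, norm_one_pow])
    refine h1.unique ?_
    have h2 : ∀ n, ∫ θ in (0:ℝ)..(2 * π), (starRingEnd ℂ) (circlePt 1 θ ^ m) * (c n * circlePt 1 θ ^ n) =
        if n = m then 2 * π * c m else 0 := by
      intro n
      have : ∀ θ, (starRingEnd ℂ) (circlePt 1 θ ^ m) * (c n * circlePt 1 θ ^ n) =
        c n * ((starRingEnd ℂ) (circlePt 1 θ ^ m) * circlePt 1 θ ^ n) := fun θ => by ring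
      simp_rw [this]
      rw [intervalIntegral.integral_const_mul, orth]
      split_ifs with h
      · rw [h]; ring
      · simp
    simp_rw [h2]
    exact hasSum_ite_eq m _
  have hconj : ∀ g : ℝ → ℂ, ∫ θ in (0:ℝ)..(2 * π), (starRingEnd ℂ) (g θ) =
      (starRingEnd ℂ) (∫ θ in (0:ℝ)..(2 * π), g θ) := by
    intro g
    rw [intervalIntegral.integral_of_le (by positivity), intervalIntegral.integral_of_le (by positivity), integral_conj]
  have h3 := hasSum_int c hc (fun θ => (starRingEnd ℂ) (S θ)) (by fun_prop) _ (fun θ => by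
    rw [RCLike.norm_conj]; exact hSb θ)
  have h4 : ∀ n, ∫ θ in (0:ℝ)..(2 * π), (starRingEnd ℂ) (S θ) * (c n * circlePt 1 θ ^ n) =
      ((2 * π * ‖c n‖ ^ 2 : ℝ) : ℂ) := by
    intro n
    have : ∀ θ, (starRingEnd ℂ) (S θ) * (c n * circlePt 1 θ ^ n) =
        c n * (starRingEnd ℂ) ((starRingEnd ℂ) (circlePt 1 θ ^ n) * S θ) := fun θ => by
      simp only [map_mul, Complex.conj_conj]; ring
    simp_rw [this]
    rw [intervalIntegral.integral_const_mul, hconj, hA]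
    simp only [map_mul, Complex.conj_ofReal, map_ofNat]
    rw [show c n * (2 * π * (starRingEnd ℂ) (c n)) = 2 * π * (c n * (starRingEnd ℂ) (c n)) by ring,
      Complex.mul_conj']
    push_cast; ring
  have h5 : ∀ θ, (starRingEnd ℂ) (S θ) * ∑' n, c n * circlePt 1 θ ^ n = ((‖S θ‖ ^ 2 : ℝ) : ℂ) := by
    intro θ
    change (starRingEnd ℂ) (S θ) * S θ = _
    rw [Complex.conj_mul']; push_cast; ring
  simp_rw [h4, h5] at h3
  rw [intervalIntegral.integral_ofReal] at h3
  exact_mod_cast h3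

/-- Taylor coefficients at `0`. -/
def tc (f : ℂ → ℂ) (n : ℕ) : ℂ := (n.factorial : ℂ)⁻¹ * iteratedDeriv n f 0

theorem taylor (f : ℂ → ℂ) (hf : DifferentiableOn ℂ f unitDisk) (z : ℂ) (hz : z ∈ unitDisk) :
    HasSum (fun n => tc f n * z ^ n) (f z) := by
  have := Complex.hasSum_taylorSeries_on_ball hf hz
  have h : (fun n => tc f n * z ^ n) = fun n : ℕ => ((n.factorial : ℂ))⁻¹ • (z - 0) ^ n • iteratedDeriv n f 0 := by
    funext n
    simp only [tc, sub_zero, smul_eq_mul]; ring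
  rw [h]; exact this

theorem L2 (f : ℂ → ℂ) (a : ℕ → ℂ) (ha : ∀ z ∈ unitDisk, HasSum (fun n => a n * z ^ n) (f z)) (R : ℝ)
    (hR : R ∈ Ico (0:ℝ) 1) :
    HasSum (fun n => 2 * π * (‖a n‖ ^ 2 * (R ^ n) ^ 2))
      (∫ θ in (0:ℝ)..(2 * π), ‖f (circlePt R θ)‖ ^ 2) := by
  have hs : Summable fun n => ‖a n * (R:ℂ) ^ n‖ := by
    have := (ha (R:ℂ) (by simp [unitDisk, abs_of_nonneg hR.1, hR.2])).summable
    exact this.norm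
  have h := parseval (fun n => a n * (R:ℂ) ^ n) hs
  have h1 : ∀ θ, ∑' n, a n * (R:ℂ) ^ n * circlePt 1 θ ^ n = f (circlePt R θ) := by
    intro θ
    rw [← (ha _ (circlePt_mem θ hR.1 hR.2)).tsum_eq]
    refine tsum_congr fun n => ?_
    have : circlePt R θ = R * circlePt 1 θ := by rw [← circlePt_mul, mul_one]
    rw [this, mul_pow]; ring
  simp_rw [h1] at h
  convert h using 2 with n
  simp [mul_pow, abs_of_nonneg hR.1]

end MpNp

namespace MpNp

theorem summable_sq (f : ℂ → ℂ) (a : ℕ → ℂ) (ha : ∀ z ∈ unitDisk, HasSum (fun n => a n * z ^ n) (f z))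
    (B : ℝ) (hB : ∀ z ∈ unitDisk, ‖f z‖ ≤ B) : Summable fun n => ‖a n‖ ^ 2 := by
  refine summable_of_sum_range_le (c := B ^ 2) (fun n => by positivity) fun N => ?_
  have h1 : ∀ k : ℕ, ∑ n ∈ Finset.range N, ‖a n‖ ^ 2 * (rad k ^ n) ^ 2 ≤ B ^ 2 := by
    intro k
    have hk := rad_mem k
    have h := L2 f a ha (rad k) ⟨hk.1.le, hk.2⟩
    have h2 := sum_le_hasSum (Finset.range N) (fun n _ => by positivity) h
    have h3 : ∫ θ in (0:ℝ)..(2 * π), ‖f (circlePt (rad k) θ)‖ ^ 2 ≤ 2 * π * B ^ 2 := by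
      have h4 : ‖∫ θ in (0:ℝ)..(2 * π), ‖f (circlePt (rad k) θ)‖ ^ 2‖ ≤ B ^ 2 * |2 * π - 0| := by
        refine intervalIntegral.norm_integral_le_of_norm_le_const fun θ _ => ?_
        rw [norm_pow, norm_norm]
        have := hB _ (circlePt_mem θ hk.1.le hk.2)
        gcongr
      rw [sub_zero, abs_of_pos (by positivity), Real.norm_eq_abs] at h4
      linarith [le_abs_self (∫ θ in (0:ℝ)..(2 * π), ‖f (circlePt (rad k) θ)‖ ^ 2)]
    rw [← Finset.mul_sum] at h2
    have := h2.trans h3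
    exact le_of_mul_le_mul_left this (by positivity)
  have h2 : Tendsto (fun k => ∑ n ∈ Finset.range N, ‖a n‖ ^ 2 * (rad k ^ n) ^ 2) atTop
      (𝓝 (∑ n ∈ Finset.range N, ‖a n‖ ^ 2 * (1 ^ n) ^ 2)) :=
    tendsto_finsetSum _ fun n _ => ((rad_tendsto.pow n).pow 2).const_mul _
  have h3 := le_of_tendsto' h2 h1
  simpa using h3

theorem fatou_bounded (f : ℂ → ℂ) (hf : DifferentiableOn ℂ f unitDisk) (B : ℝ)
    (hB : ∀ z ∈ unitDisk, ‖f z‖ ≤ B) :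
    ∀ᵐ θ ∂(volume.restrict (Ioc 0 (2 * π))),
      ∃ l : ℂ, Tendsto (fun r => f (circlePt r θ)) (𝓝[<] 1) (𝓝 l) := by
  have ha := taylor f hf
  set a := tc f with ha_def
  have hsum := summable_sq f a ha B hB
  obtain ⟨C, hC, hT⟩ := T 2 one_lt_two
  have hdil : ∀ k, ∀ z ∈ unitDisk, (rad k : ℂ) * z ∈ unitDisk := by
    intro k z hz
    have hz' : ‖z‖ < 1 := by simpa [unitDisk] using hz
    have := rad_mem k
    simp only [unitDisk, Metric.mem_ball, dist_zero_right, norm_mul, Complex.norm_real, Real.norm_eq_abs, abs_of_pos this.1]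
    nlinarith [norm_nonneg z, this.1, this.2]
  set h : ℕ → ℂ → ℂ := fun k z => f z - f ((rad k : ℂ) * z) with hh
  have hhd : ∀ k, DifferentiableOn ℂ (h k) unitDisk := fun k =>
    hf.sub (hf.comp (by fun_prop) (hdil k))
  have hha : ∀ k, ∀ z ∈ unitDisk, HasSum (fun n => (a n * (1 - (rad k : ℂ) ^ n)) * z ^ n) (h k z) := by
    intro k z hz
    have e : (fun n => (a n * (1 - (rad k : ℂ) ^ n)) * z ^ n) =
        fun n => a n * z ^ n - a n * ((rad k : ℂ) * z) ^ n := by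
      funext n; rw [mul_pow]; ring
    rw [e]
    exact (ha z hz).sub (ha _ (hdil k z hz))
  set E : ℕ → ℝ := fun k => ∑' n, 2 * π * (‖a n‖ ^ 2 * (1 - rad k ^ n) ^ 2) with hE
  have hpow : ∀ k n, 0 ≤ 1 - rad k ^ n ∧ 1 - rad k ^ n ≤ 1 := fun k n => by
    have h1 := pow_le_one₀ (n := n) (rad_mem k).1.le (rad_mem k).2.le
    have h2 := pow_nonneg (rad_mem k).1.le n
    constructor <;> linarith
  have hbd : ∀ k n, 2 * π * (‖a n‖ ^ 2 * (1 - rad k ^ n) ^ 2) ≤ 2 * π * ‖a n‖ ^ 2 := by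
    intro k n
    have : (1 - rad k ^ n) ^ 2 ≤ 1 := pow_le_one₀ (hpow k n).1 (hpow k n).2
    have h3 : ‖a n‖ ^ 2 * (1 - rad k ^ n) ^ 2 ≤ ‖a n‖ ^ 2 := mul_le_of_le_one_right (by positivity) this
    gcongr
  have hEsum : ∀ k, Summable fun n => 2 * π * (‖a n‖ ^ 2 * (1 - rad k ^ n) ^ 2) := fun k =>
    Summable.of_nonneg_of_le (fun n => by positivity) (hbd k) (hsum.mul_left _)
  have hE0 : Tendsto E atTop (𝓝 0) := by
    have := tendsto_tsum_of_dominated_convergence (𝓕 := atTop)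
      (f := fun k n => 2 * π * (‖a n‖ ^ 2 * (1 - rad k ^ n) ^ 2)) (g := fun n => 2 * π * (‖a n‖ ^ 2 * (1 - 1 ^ n) ^ 2))
      (hsum.mul_left (2 * π)) (fun n => by
        exact (((tendsto_const_nhds.sub (rad_tendsto.pow n)).pow 2).const_mul _).const_mul _)
      (Eventually.of_forall fun k n => by
        rw [Real.norm_of_nonneg (by positivity)]; exact hbd k n)
    simpa using this
  have hInteg : ∀ k, ∫⁻ θ in Ioc 0 (2 * π), wmax (h k) θ ^ (2:ℝ) ≤ C * ENNReal.ofReal (E k) := by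
    intro k
    refine (hT (h k) rad (hhd k) rad_mem rad_tendsto).trans ?_
    refine (liminf_le_liminf (v := fun _ => C * ENNReal.ofReal (E k)) (Eventually.of_forall fun n => ?_)).trans_eq (liminf_const _)
    refine mul_le_mul_right ?_ _
    have hn := rad_mem n
    have hL := L2 (h k) _ (hha k) (rad n) ⟨hn.1.le, hn.2⟩
    have hcont : Continuous fun θ => ‖h k (circlePt (rad n) θ)‖ ^ 2 :=
      (((hhd k).continuousOn.comp_continuous (continuous_circlePt _) fun θ => circlePt_mem θ hn.1.le hn.2).norm).pow 2
    calc _ ≤ ∫⁻ θ in Ioc 0 (2 * π), ENNReal.ofReal (‖h k (circlePt (rad n) θ)‖ ^ 2) := by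
          refine lintegral_mono fun θ => ?_
          rw [ENNReal.ofReal_rpow_of_nonneg (Real.log_nonneg (by simp)) (by norm_num)]
          refine ENNReal.ofReal_le_ofReal ?_
          rw [Real.rpow_two]
          refine pow_le_pow_left₀ (Real.log_nonneg (by simp)) ?_ 2
          have := Real.log_le_sub_one_of_pos (x := 1 + ‖h k (circlePt (rad n) θ)‖) (by positivity)
          linarith
      _ = ENNReal.ofReal (∫ θ in (0:ℝ)..(2 * π), ‖h k (circlePt (rad n) θ)‖ ^ 2) := by
          rw [intervalIntegral.integral_of_le (by positivity), ofReal_integral_eq_lintegral_ofReal hcont.integrableOn_Ioc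
            (Eventually.of_forall fun φ => by positivity)]
      _ ≤ _ := by
          refine ENNReal.ofReal_le_ofReal (hasSum_le (fun m => ?_) hL (hEsum k).hasSum)
          have h1 : ‖a m * (1 - (rad k : ℂ) ^ m)‖ ^ 2 = ‖a m‖ ^ 2 * (1 - rad k ^ m) ^ 2 := by
            rw [norm_mul, mul_pow, show (1 - (rad k : ℂ) ^ m) = ((1 - rad k ^ m : ℝ) : ℂ) by push_cast; ring,
              Complex.norm_real, Real.norm_eq_abs, sq_abs]
          rw [h1]
          have h2 : (rad n ^ m) ^ 2 ≤ 1 := pow_le_one₀ (pow_nonneg hn.1.le _) (pow_le_one₀ hn.1.le hn.2.le)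
          have h3 : ‖a m‖ ^ 2 * (1 - rad k ^ m) ^ 2 * (rad n ^ m) ^ 2 ≤ ‖a m‖ ^ 2 * (1 - rad k ^ m) ^ 2 :=
            mul_le_of_le_one_right (by positivity) h2
          gcongr
  have hmeas : ∀ k, Measurable fun θ => wmax (h k) θ ^ (2:ℝ) := fun k =>
    (measurable_wmax _ (hhd k).continuousOn).pow_const _
  have hzero : ∫⁻ θ in Ioc 0 (2 * π), ⨅ k, wmax (h k) θ ^ (2:ℝ) = 0 := by
    have hlim : Tendsto (fun k => C * ENNReal.ofReal (E k)) atTop (𝓝 0) := by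
      have := ENNReal.Tendsto.const_mul (a := C) (ENNReal.tendsto_ofReal hE0) (Or.inr hC)
      simpa using this
    refine le_antisymm (ge_of_tendsto' hlim fun k => ?_) zero_le
    exact (lintegral_mono fun θ => iInf_le _ k).trans (hInteg k)
  rw [lintegral_eq_zero_iff (Measurable.iInf hmeas)] at hzero
  filter_upwards [hzero] with θ hθ
  rw [← cauchy_map_iff_exists_tendsto, Metric.cauchy_iff]
  refine ⟨inferInstance, fun ε hε => ?_⟩
  have hη : 0 < Real.log (1 + ε / 4) := Real.log_pos (by linarith)
  have hlt : ⨅ k, wmax (h k) θ ^ (2:ℝ) < ENNReal.ofReal (Real.log (1 + ε / 4)) ^ (2:ℝ) := by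
    have h0 : ⨅ k, wmax (h k) θ ^ (2:ℝ) = 0 := hθ
    rw [h0]
    exact ENNReal.rpow_pos (by simpa using hη) ENNReal.ofReal_ne_top
  obtain ⟨k, hk⟩ := iInf_lt_iff.1 hlt
  rw [ENNReal.rpow_lt_rpow_iff (by norm_num)] at hk
  have hsmall : ∀ r ∈ Ico (0:ℝ) 1, ‖f (circlePt r θ) - f ((rad k : ℂ) * circlePt r θ)‖ < ε / 4 := by
    intro r hr
    have h1 := (le_wmax (h k) θ r hr).trans_lt hk
    rw [ENNReal.ofReal_lt_ofReal_iff hη, Real.log_lt_log_iff (by positivity) (by positivity)] at h1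
    simp only [hh] at h1
    linarith
  have hcont : Tendsto (fun r : ℝ => f ((rad k : ℂ) * circlePt r θ)) (𝓝[<] 1) (𝓝 (f ((rad k : ℂ) * circlePt 1 θ))) := by
    have hmem : (rad k : ℂ) * circlePt 1 θ ∈ unitDisk := by
      rw [← circlePt_mul, mul_one]; exact circlePt_mem θ (rad_mem k).1.le (rad_mem k).2
    have h1 : ContinuousAt f ((rad k : ℂ) * circlePt 1 θ) :=
      hf.continuousOn.continuousAt (Metric.isOpen_ball.mem_nhds hmem)
    have h2 : Continuous fun r : ℝ => (rad k : ℂ) * circlePt r θ := by unfold circlePt; fun_prop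
    exact (h1.tendsto.comp (h2.tendsto 1)).mono_left nhdsWithin_le_nhds
  have hev : ∀ᶠ r in 𝓝[<] (1:ℝ), ‖f (circlePt r θ) - f ((rad k : ℂ) * circlePt 1 θ)‖ < ε / 2 := by
    have h0 : ∀ᶠ r in 𝓝[<] (1:ℝ), r ∈ Ico (0:ℝ) 1 := by
      filter_upwards [Ioo_mem_nhdsLT (zero_lt_one' ℝ)] with r hr using ⟨hr.1.le, hr.2⟩
    filter_upwards [h0, (Metric.tendsto_nhds.1 hcont) (ε/4) (by positivity)] with r hr h2
    rw [dist_eq_norm] at h2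
    have h3 := norm_sub_le_norm_sub_add_norm_sub (f (circlePt r θ)) (f ((rad k : ℂ) * circlePt r θ)) (f ((rad k : ℂ) * circlePt 1 θ))
    linarith [hsmall r hr]
  refine ⟨_, image_mem_map hev, ?_⟩
  rintro _ ⟨r, hr, rfl⟩ _ ⟨s, hs, rfl⟩
  have h3 := dist_triangle_right (f (circlePt r θ)) (f (circlePt s θ)) (f ((rad k : ℂ) * circlePt 1 θ))
  rw [dist_eq_norm _ (f ((rad k : ℂ) * circlePt 1 θ)), dist_eq_norm _ (f ((rad k : ℂ) * circlePt 1 θ))] at h3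
  have hr' : ‖f (circlePt r θ) - f ((rad k : ℂ) * circlePt 1 θ)‖ < ε / 2 := hr
  have hs' : ‖f (circlePt s θ) - f ((rad k : ℂ) * circlePt 1 θ)‖ < ε / 2 := hs
  linarith

end MpNp

namespace MpNp

/-- The maximal function as a function on the circle. -/
def wc (f : ℂ → ℂ) (ζ : ℂ) : ℝ :=
  (⨆ r ∈ Ico (0:ℝ) 1, ENNReal.ofReal (Real.log (1 + ‖f ((r:ℂ) * ζ)‖))).toReal

theorem wc_circle (f : ℂ → ℂ) (θ : ℝ) : wc f (circleMap 0 1 θ) = (wmax f θ).toReal := by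
  unfold wc wmax
  simp only [← circlePt_eq, ← circlePt_mul, mul_one]

theorem wmax_fin (p : ℝ) (hp : 1 < p) (f : ℂ → ℂ) (hInteg : ∫⁻ θ in Ioc 0 (2 * π), wmax f θ ^ p < ∞) :
    ∫⁻ θ in Ioc 0 (2 * π), wmax f θ ≠ ∞ := by
  have h1 : ∫⁻ θ in Ioc 0 (2 * π), wmax f θ ≤ ∫⁻ θ in Ioc 0 (2 * π), (1 + wmax f θ ^ p) := by
    refine lintegral_mono fun θ => ?_
    rcases le_total (wmax f θ) 1 with h | h
    · exact le_add_right h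
    · refine le_add_left ?_
      calc wmax f θ = wmax f θ ^ (1:ℝ) := (ENNReal.rpow_one _).symm
        _ ≤ _ := ENNReal.rpow_le_rpow_of_exponent_le h hp.le
  refine ne_top_of_le_ne_top ?_ h1
  rw [lintegral_add_left measurable_const, setLIntegral_const]
  refine ENNReal.add_ne_top.2 ⟨?_, hInteg.ne⟩
  rw [one_mul, Real.volume_Ioc]
  exact ENNReal.ofReal_ne_top

theorem exists_majorant (p : ℝ) (hp : 1 < p) (f : ℂ → ℂ) (hf : DifferentiableOn ℂ f unitDisk)
    (hInteg : ∫⁻ θ in Ioc 0 (2 * π), wmax f θ ^ p < ∞) :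
    ∃ H : ℂ → ℂ, DifferentiableOn ℂ H unitDisk ∧ ∀ z ∈ unitDisk,
      Real.log (1 + ‖f z‖) ≤ (H z).re := by
  have hfin := wmax_fin p hp f hInteg
  have hmeas := measurable_wmax f hf.continuousOn
  have hI : CircleIntegrable (wc f) 0 1 := by
    unfold CircleIntegrable
    simp only [wc_circle]
    rw [intervalIntegrable_iff_integrableOn_Ioc_of_le (by positivity)]
    exact integrable_toReal_of_lintegral_ne_top hmeas.aemeasurable hfin
  have hIc : CircleIntegrable (fun ζ => (wc f ζ : ℂ)) 0 1 := by
    simp only [CircleIntegrable, intervalIntegrable_iff] at hI ⊢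
    exact Complex.ofRealCLM.integrable_comp hI
  refine ⟨_, differentiableOn_circleAverage_herglotzRieszKernel_smul hIc, fun w hw => ?_⟩
  rw [re_circleAverage_herglotzRieszKernel_smul hI hw, ← poissonKernel_eq_re_herglotzRieszKernel]
  have hlim : Tendsto (fun n => Real.log (1 + ‖f ((rad n : ℂ) * w)‖)) atTop (𝓝 (Real.log (1 + ‖f w‖))) := by
    have h1 : ContinuousAt f w := hf.continuousOn.continuousAt (Metric.isOpen_ball.mem_nhds hw)
    have h2 : Tendsto (fun n => (rad n : ℂ) * w) atTop (𝓝 w) := by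
      have := ((Complex.continuous_ofReal.tendsto 1).comp rad_tendsto).mul_const w
      simpa using this
    exact ((h1.tendsto.comp h2).norm.const_add 1).log (by positivity)
  refine le_of_tendsto' hlim fun n => ?_
  have hmaps : MapsTo (fun z : ℂ => (rad n : ℂ) * z) (Metric.closedBall 0 1) unitDisk := by
    intro z hz
    have hz' : ‖z‖ ≤ 1 := by simpa using hz
    have h1 := (rad_mem n).1; have := (rad_mem n).2
    simp only [unitDisk, Metric.mem_ball, dist_zero_right, norm_mul, Complex.norm_real, Real.norm_eq_abs, abs_of_pos h1]
    nlinarith [norm_nonneg z]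
  have hFd : DifferentiableOn ℂ (fun z => f ((rad n : ℂ) * z)) (Metric.closedBall 0 1) :=
    hf.comp (by fun_prop) hmaps
  have hF : DiffContOnCl ℂ (fun z => f ((rad n : ℂ) * z)) (Metric.ball 0 1) := by
    refine DifferentiableOn.diffContOnCl ?_
    rwa [closure_ball _ one_ne_zero]
  refine (log_le_poisson _ hF hw).trans ?_
  have hc1 : ContinuousOn (fun ζ => poissonKernel 0 w ζ * Real.log (1 + ‖f ((rad n : ℂ) * ζ)‖)) (Metric.sphere 0 1) :=
    (continuousOn_pk hw).mul ((continuousOn_const.add (hFd.continuousOn.mono Metric.sphere_subset_closedBall).norm).log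
      fun z _ => (by positivity : (0:ℝ) < 1 + ‖f ((rad n : ℂ) * z)‖).ne')
  have hi1 := hc1.circleIntegrable zero_le_one
  have hi2 : CircleIntegrable (poissonKernel 0 w • wc f) 0 1 :=
    hI.continuousOn_smul (by rw [abs_one]; exact continuousOn_pk hw)
  rw [Real.circleAverage_def, Real.circleAverage_def]
  refine smul_le_smul_of_nonneg_left ?_ (by positivity)
  unfold CircleIntegrable at hi1 hi2
  rw [intervalIntegrable_iff_integrableOn_Ioc_of_le (by positivity)] at hi1 hi2
  rw [intervalIntegral.integral_of_le (by positivity), intervalIntegral.integral_of_le (by positivity)]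
  refine integral_mono_ae hi1 hi2 ?_
  filter_upwards [ae_lt_top hmeas hfin] with θ hθ
  simp only [Pi.smul_apply', smul_eq_mul, wc_circle]
  refine mul_le_mul_of_nonneg_left ?_ (pk_nonneg hw (by simp))
  rw [← ENNReal.ofReal_le_iff_le_toReal hθ.ne]
  have := le_wmax f θ (rad n) ⟨(rad_mem n).1.le, (rad_mem n).2⟩
  rwa [show (rad n : ℂ) * circleMap 0 1 θ = circlePt (rad n) θ by
    rw [← circlePt_eq, ← circlePt_mul, mul_one]]

theorem fatou_Mp (p : ℝ) (hp : 1 < p) (f : ℂ → ℂ) (hf : DifferentiableOn ℂ f unitDisk)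
    (hInteg : ∫⁻ θ in Ioc 0 (2 * π), wmax f θ ^ p < ∞) :
    ∀ᵐ θ ∂(volume.restrict (Ioc 0 (2 * π))),
      ∃ l : ℂ, Tendsto (fun r => f (circlePt r θ)) (𝓝[<] 1) (𝓝 l) := by
  obtain ⟨H, hH, hle⟩ := exists_majorant p hp f hf hInteg
  have hre0 : ∀ z ∈ unitDisk, 0 ≤ (H z).re := fun z hz =>
    (Real.log_nonneg (by simp)).trans (hle z hz)
  set g : ℂ → ℂ := fun z => Complex.exp (-H z) with hg
  have hgd : DifferentiableOn ℂ g unitDisk := hH.neg.cexp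
  have hgn : ∀ z, ‖g z‖ = Real.exp (-(H z).re) := fun z => by simp [hg, Complex.norm_exp]
  have h1 := fatou_bounded g hgd 1 (fun z hz => by
    rw [hgn, Real.exp_le_one_iff]; linarith [hre0 z hz])
  have h2 := fatou_bounded (fun z => f z * g z) (hf.mul hgd) 1 (fun z hz => by
    rw [norm_mul, hgn, Real.exp_neg, ← div_eq_mul_inv, div_le_one (Real.exp_pos _)]
    have := (Real.log_le_iff_le_exp (by positivity)).1 (hle z hz)
    linarith)
  have hcH : ∀ n, Continuous fun θ => H (circlePt (rad n) θ) := fun n =>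
    hH.continuousOn.comp_continuous (continuous_circlePt _) fun θ => circlePt_mem θ (rad_mem n).1.le (rad_mem n).2
  have hcR : ∀ n, Continuous fun θ => (H (circlePt (rad n) θ)).re := fun n => Complex.continuous_re.comp (hcH n)
  have hmean : ∀ n, ∫⁻ θ in Ioc 0 (2 * π), ENNReal.ofReal (H (circlePt (rad n) θ)).re =
      ENNReal.ofReal (2 * π * (H 0).re) := by
    intro n
    rw [← ofReal_integral_eq_lintegral_ofReal (hcR n).integrableOn_Ioc
      (Eventually.of_forall fun θ => hre0 _ (circlePt_mem θ (rad_mem n).1.le (rad_mem n).2))]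
    congr 1
    have hd : DiffContOnCl ℂ H (Metric.ball 0 |rad n|) := by
      refine DifferentiableOn.diffContOnCl (hH.mono ?_)
      rw [abs_of_pos (rad_mem n).1, closure_ball _ (rad_mem n).1.ne']
      exact Metric.closedBall_subset_ball (rad_mem n).2
    have h := hd.circleAverage
    rw [Real.circleAverage_def] at h
    have h' : ∫ θ in (0:ℝ)..(2 * π), H (circleMap 0 (rad n) θ) = (2 * π : ℝ) • H 0 := by
      rw [← h, smul_smul, mul_inv_cancel₀ (by positivity), one_smul]
    have h3 := congrArg Complex.re h'
    rw [intervalIntegral.integral_of_le (by positivity)] at h3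
    have h4 := integral_re (𝕜 := ℂ) (μ := volume.restrict (Ioc 0 (2 * π))) (f := fun θ => H (circlePt (rad n) θ)) (hcH n).integrableOn_Ioc
    simp only [circlePt_eq] at h4 ⊢
    refine Eq.trans h4 (Eq.trans h3 ?_)
    simp
  have hlim : ∫⁻ θ in Ioc 0 (2 * π), liminf (fun n => ENNReal.ofReal (H (circlePt (rad n) θ)).re) atTop ≠ ∞ := by
    refine ne_top_of_le_ne_top (ENNReal.ofReal_ne_top (r := 2 * π * (H 0).re)) ?_
    refine (lintegral_liminf_le fun n => (hcR n).measurable.ennreal_ofReal).trans ?_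
    simp only [hmean]
    rw [liminf_const]
  have h3 := ae_lt_top (Measurable.liminf fun n => (hcR n).measurable.ennreal_ofReal) hlim
  filter_upwards [h1, h2, h3] with θ ⟨a, ha⟩ ⟨b, hb⟩ hfinθ
  have ha0 : a ≠ 0 := by
    intro h0
    rw [h0] at ha
    have h4 := (ha.comp rad_tendsto').norm
    simp only [Function.comp_def, hgn, norm_zero] at h4
    have h5 : Tendsto (fun n => (H (circlePt (rad n) θ)).re) atTop atTop := by
      have := Real.tendsto_exp_comp_nhds_zero.1 h4
      simpa using this
    have h6 : Tendsto (fun n => ENNReal.ofReal (H (circlePt (rad n) θ)).re) atTop (𝓝 ∞) :=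
      ENNReal.tendsto_ofReal_atTop.comp h5
    rw [h6.liminf_eq] at hfinθ
    exact lt_irrefl _ hfinθ
  refine ⟨b / a, (hb.div ha ha0).congr fun r => ?_⟩
  simp only [Pi.div_apply]
  exact mul_div_cancel_right₀ _ (Complex.exp_ne_zero _)

end MpNp

namespace MpNp

theorem wmax_sub (f g : ℂ → ℂ) (θ : ℝ) : wmax (f - g) θ ≤ wmax f θ + wmax g θ := by
  refine iSup₂_le fun r hr => le_trans ?_ (add_le_add (le_wmax f θ r hr) (le_wmax g θ r hr))
  rw [← ENNReal.ofReal_add (Real.log_nonneg (by simp)) (Real.log_nonneg (by simp)),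
    ← Real.log_mul (by positivity) (by positivity)]
  refine ENNReal.ofReal_le_ofReal (Real.log_le_log (by positivity) ?_)
  have h := norm_sub_le (f (circlePt r θ)) (g (circlePt r θ))
  have h2 : 0 ≤ ‖f (circlePt r θ)‖ * ‖g (circlePt r θ)‖ := by positivity
  simp only [Pi.sub_apply]
  nlinarith

theorem sub_mem (p : ℝ) (hp : 1 < p) (f g : ℂ → ℂ) (hf : f ∈ MpClass p) (hg : g ∈ MpClass p) :
    f - g ∈ MpClass p := by
  rw [mem_Mp_iff p hp] at *
  refine ⟨hf.1.sub hg.1, ?_⟩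
  have h2 : (2:ℝ≥0∞) ^ (p - 1) ≠ ∞ := ENNReal.rpow_ne_top_of_nonneg (by linarith) (by norm_num)
  calc ∫⁻ θ in Ioc 0 (2 * π), wmax (f - g) θ ^ p
      ≤ ∫⁻ θ in Ioc 0 (2 * π), 2 ^ (p - 1) * (wmax f θ ^ p + wmax g θ ^ p) :=
        lintegral_mono fun θ => (ENNReal.rpow_le_rpow (wmax_sub f g θ) (by linarith)).trans
          (ENNReal.rpow_add_le_mul_rpow_add_rpow _ _ hp.le)
    _ = 2 ^ (p - 1) * ((∫⁻ θ in Ioc 0 (2 * π), wmax f θ ^ p) + ∫⁻ θ in Ioc 0 (2 * π), wmax g θ ^ p) := by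
        rw [lintegral_const_mul' _ _ h2, lintegral_add_left ((measurable_wmax f hf.1.continuousOn).pow_const _)]
    _ < ∞ := ENNReal.mul_lt_top h2.lt_top (ENNReal.add_lt_top.2 ⟨hf.2, hg.2⟩)

theorem log_tendsto {u : ℕ → ℂ} {l : ℂ} (h : Tendsto u atTop (𝓝 l)) :
    Tendsto (fun n => ENNReal.ofReal (Real.log (1 + ‖u n‖))) atTop (𝓝 (ENNReal.ofReal (Real.log (1 + ‖l‖)))) :=
  ENNReal.tendsto_ofReal ((h.norm.const_add 1).log (by positivity))

theorem key (p : ℝ) (hp : 1 < p) : ∃ C : ℝ≥0∞, C ≠ ∞ ∧ ∀ f g : ℂ → ℂ, f ∈ MpClass p → g ∈ MpClass p →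
    dMetric p f g ≤ rhoMetric p f g ∧ rhoMetric p f g ≤ C * dMetric p f g := by
  obtain ⟨C, hC, hT⟩ := T p hp
  have hp0 : 0 < p := by linarith
  refine ⟨C ^ (1 / p), ENNReal.rpow_ne_top_of_nonneg (by positivity) hC, fun f g hf hg => ?_⟩
  have hh := sub_mem p hp f g hf hg
  rw [mem_Mp_iff p hp] at hf hg hh
  have hlim : ∀ᵐ θ ∂(volume.restrict (Ioc 0 (2 * π))),
      Tendsto (fun n => (f - g) (circlePt (rad n) θ)) atTop (𝓝 (radialLimit f θ - radialLimit g θ)) := by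
    filter_upwards [fatou_Mp p hp f hf.1 hf.2, fatou_Mp p hp g hg.1 hg.2] with θ ⟨a, ha⟩ ⟨b, hb⟩
    have e1 : radialLimit f θ = a := ha.limUnder_eq
    have e2 : radialLimit g θ = b := hb.limUnder_eq
    rw [e1, e2]
    exact (ha.comp rad_tendsto').sub (hb.comp rad_tendsto')
  have hmem : ∀ n, rad n ∈ Ico (0:ℝ) 1 := fun n => ⟨(rad_mem n).1.le, (rad_mem n).2⟩
  constructor
  · unfold dMetric rhoMetric
    refine ENNReal.rpow_le_rpow (ENNReal.div_le_div_right (lintegral_mono_ae ?_) _) (by positivity)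
    filter_upwards [hlim] with θ hθ
    rw [elog1p_maxRad]
    refine ENNReal.rpow_le_rpow (le_of_tendsto' (log_tendsto hθ) fun n => ?_) hp0.le
    exact le_wmax (f - g) θ (rad n) (hmem n)
  · unfold dMetric rhoMetric
    rw [← ENNReal.mul_rpow_of_nonneg _ _ (by positivity), ← mul_div_assoc]
    refine ENNReal.rpow_le_rpow (ENNReal.div_le_div_right ?_ _) (by positivity)
    simp only [elog1p_maxRad]
    refine (hT (f - g) rad hh.1 rad_mem rad_tendsto).trans (le_of_eq ?_)
    refine Tendsto.liminf_eq (ENNReal.Tendsto.const_mul ?_ (Or.inr hC))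
    refine tendsto_lintegral_of_dominated_convergence (fun θ => wmax (f - g) θ ^ p) (fun n => ?_) (fun n => ?_) hh.2.ne ?_
    · exact ((continuous_log_comp _ hh.1.continuousOn _ (hmem n).1 (hmem n).2).measurable.ennreal_ofReal).pow_const _
    · exact Eventually.of_forall fun θ => ENNReal.rpow_le_rpow (le_wmax (f - g) θ (rad n) (hmem n)) hp0.le
    · filter_upwards [hlim] with θ hθ
      exact ((ENNReal.continuous_rpow_const (y := p)).tendsto _).comp (log_tendsto hθ)

end MpNp

/-- For `p > 1` the classes `M^p` and `N^p` coincide, and the metrics `ρ_p`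
and `d_p` induce the same topology (the identity map is a homeomorphism; equivalently, for
metric spaces, they have the same convergent sequences). -/
theorem Mp_eq_Np_and_same_topology (p : ℝ) (hp : 1 < p) :
    MpClass p = NpClass p ∧
    ∀ (F : ℕ → ℂ → ℂ) (f : ℂ → ℂ), (∀ n, F n ∈ MpClass p) → f ∈ MpClass p →
      (Tendsto (fun n => rhoMetric p (F n) f) atTop (nhds 0) ↔
        Tendsto (fun n => dMetric p (F n) f) atTop (nhds 0)) := by
  refine ⟨MpNp.Mp_eq_Np p hp, fun F f hF hf => ?_⟩
  obtain ⟨C, hC, hk⟩ := MpNp.key p hp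
  constructor
  · intro h
    exact tendsto_of_tendsto_of_tendsto_of_le_of_le tendsto_const_nhds h (fun _ => zero_le) fun n => (hk _ _ (hF n) hf).1
  · intro h
    have h2 := ENNReal.Tendsto.const_mul (a := C) h (Or.inr hC)
    rw [mul_zero] at h2
    exact tendsto_of_tendsto_of_tendsto_of_le_of_le tendsto_const_nhds h2 (fun _ => zero_le) fun n => (hk _ _ (hF n) hf).2
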